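/- arXiv:2211.08145 — 2 statements merged into one kernel-verified Lean document; each statement's English description precedes it below -/
import Mathlib

section
/- Let G be a finitely generated nilpotent group that is not virtually cyclic, i.e. G has no cyclic subgroup of finite index. Then G does not have the strong topological Rokhlin property. -/
open Topology

/-- The Cantor space `𝒞`. -/
abbrev Cantor : Type := ℕ → Bool

/-- `α : G → C(𝒞,𝒞)` is a continuous action if it is a homomorphism into the
self-homeomorphisms of `𝒞` (recorded as continuous maps; continuity of the inverse
`α g⁻¹` is automatic from the homomorphism equations). -/
def IsAction (G : Type) [Group G] (α : G → C(Cantor, Cantor)) : Prop :=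
  α 1 = ContinuousMap.id Cantor ∧ ∀ g h : G, α (g * h) = (α g).comp (α h)

/-- The space `Act_G(𝒞)` of continuous actions of `G` on the Cantor space,
topologized as a subspace of `C(𝒞,𝒞)^G` (compact-open topology on each factor). -/
abbrev ActSpace (G : Type) [Group G] : Type :=
  {α : G → C(Cantor, Cantor) // IsAction G α}

/-- The conjugacy class of an action `α` under the conjugation action of `Homeo(𝒞)`. -/
def conjClass {G : Type} [Group G] (α : ActSpace G) : Set (ActSpace G) :=
  {β | ∃ φ : Cantor ≃ₜ Cantor, ∀ g : G,
    (β.1 g : Cantor → Cantor) = φ ∘ (α.1 g : Cantor → Cantor) ∘ φ.symm}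

/-- The strong topological Rokhlin property: some action on the Cantor space has a
comeager conjugacy class. -/
def HasSTRP (G : Type) [Group G] : Prop :=
  ∃ α : ActSpace G, conjClass α ∈ residual (ActSpace G)

/-- The shift action of `G` on `A^G`: `(g • x)(h) = x(g⁻¹h)`. -/
def shift {G : Type} [Group G] {A : Type} (g : G) (x : G → A) : G → A :=
  fun h => x (g⁻¹ * h)

/-- A subshift: closed (in the product of discrete topologies) and shift-invariant. -/
def IsSubshift (G : Type) [Group G] (A : Type) (X : Set (G → A)) : Prop :=
  (letI : TopologicalSpace A := ⊥; IsClosed X) ∧ ∀ g : G, ∀ x ∈ X, shift g x ∈ X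

/-- The set `X_F` of `F`-patterns of `X`. -/
def patterns {G A : Type} (F : Finset G) (X : Set (G → A)) : Set (F → A) :=
  (fun (x : G → A) (f : F) => x (f : G)) '' X

/-- Subshift of finite type, with defining window `E` and allowed patterns `𝔽`. -/
def IsSFT (G : Type) [Group G] (A : Type) (X : Set (G → A)) : Prop :=
  ∃ (E : Finset G) (𝔽 : Set (E → A)),
    ∀ x : G → A, x ∈ X ↔ ∀ g : G, (fun e : E => shift g x (e : G)) ∈ 𝔽

/-- Continuity on a set, for a map between full shift spaces over discrete alphabets. -/
def ContinuousOnD {G A B : Type} (ψ : (G → B) → (G → A)) (Z : Set (G → B)) : Prop :=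
  letI : TopologicalSpace A := ⊥
  letI : TopologicalSpace B := ⊥
  ContinuousOn ψ Z

/-- `G`-equivariance of a map between shift spaces, on a set. -/
def EquivariantOn {G A B : Type} [Group G] (ψ : (G → B) → (G → A)) (Z : Set (G → B)) : Prop :=
  ∀ g : G, ∀ z ∈ Z, ψ (shift g z) = shift g (ψ z)

/-- A sofic subshift: a continuous `G`-equivariant image of a subshift of finite type. -/
def IsSofic (G : Type) [Group G] (A : Type) (X : Set (G → A)) : Prop :=
  ∃ (B : Type) (_ : Fintype B) (_ : Nontrivial B) (Z : Set (G → B))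
    (ψ : (G → B) → (G → A)),
    IsSubshift G B Z ∧ IsSFT G B Z ∧ ContinuousOnD ψ Z ∧ EquivariantOn ψ Z ∧ ψ '' Z = X

/-- The sliding block code `Φ(y)(g) = f(d ↦ y(g·d))` induced by `f : (D → B) → A`. -/
def slidingBlock {G : Type} [Group G] {A B : Type} (D : Finset G)
    (f : (D → B) → A) : (G → B) → (G → A) :=
  fun y g => f (fun d => y (g * (d : G)))

/-- A projectively isolated subshift. -/
def ProjIsolated (G : Type) [Group G] (A : Type) (X : Set (G → A)) : Prop :=
  ∃ (B : Type) (_ : Fintype B) (_ : Nontrivial B) (Y : Set (G → B))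
    (F D : Finset G) (f : (D → B) → A),
    IsSubshift G B Y ∧
    slidingBlock D f '' Y = X ∧
    ∀ Z : Set (G → B), IsSubshift G B Z → patterns F Z = patterns F Y →
      slidingBlock D f '' Z = X

/-- An isolated subshift: an SFT `X` such that for some finite `F ⊆ G` no proper
subshift has the same `F`-patterns as `X`. -/
def IsIsolated (G : Type) [Group G] (A : Type) (X : Set (G → A)) : Prop :=
  IsSFT G A X ∧ ∃ F : Finset G, ∀ Y : Set (G → A),
    IsSubshift G A Y → Y ⊂ X → patterns F Y ≠ patterns F X

/-- A strongly projectively isolated subshift: a continuous `G`-equivariant image of an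
isolated subshift. -/
def StronglyProjIsolated (G : Type) [Group G] (A : Type) (X : Set (G → A)) : Prop :=
  ∃ (B : Type) (_ : Fintype B) (_ : Nontrivial B) (Y : Set (G → B))
    (ψ : (G → B) → (G → A)),
    IsSubshift G B Y ∧ IsIsolated G B Y ∧
    ContinuousOnD ψ Y ∧ EquivariantOn ψ Y ∧ ψ '' Y = X

/-- Shadowing (the pseudo-orbit tracing property) of an action `act` of `G`,
with respect to a distance function `d`. -/
def HasShadowing {G X : Type} [Group G] (d : X → X → ℝ) (act : G → X → X) : Prop :=
  ∀ ε : ℝ, 0 < ε → ∃ (δ : ℝ) (S : Finset G), 0 < δ ∧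
    ∀ x : G → X, (∀ g : G, ∀ s ∈ S, d (act s (x g)) (x (s * g)) < δ) →
      ∃ y : X, ∀ g : G, d (x g) (act g y) < ε

/-- A finite partition of the whole space into nonempty clopen sets. -/
def IsClopenPartition {X : Type} [TopologicalSpace X] (parts : Finset (Set X)) : Prop :=
  (∀ P ∈ parts, IsClopen P ∧ P.Nonempty) ∧
  (∀ P ∈ parts, ∀ Q ∈ parts, P ≠ Q → Disjoint P Q) ∧
  (⋃ P ∈ parts, P) = Set.univ

/-- A finite partition of a subshift `X` into nonempty subsets that are clopen in `X`. -/
def IsClopenPartitionIn {G A : Type} (X : Set (G → A)) (parts : Finset (Set (G → A))) : Prop :=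
  (letI : TopologicalSpace A := ⊥;
    ∀ P ∈ parts, P.Nonempty ∧ P ⊆ X ∧ IsClopen (Subtype.val ⁻¹' P : Set X)) ∧
  (∀ P ∈ parts, ∀ Q ∈ parts, P ≠ Q → Disjoint P Q) ∧
  (⋃ P ∈ parts, P) = X

/-- `X` is `fam`-minimal: no nonempty proper subshift of `X` meets every member of `fam`. -/
def AMinimal {G A : Type} [Group G] (X : Set (G → A)) (fam : Set (Set (G → A))) : Prop :=
  ¬ ∃ Y : Set (G → A), IsSubshift G A Y ∧ Y.Nonempty ∧ Y ⊂ X ∧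
    ∀ S ∈ fam, (Y ∩ S).Nonempty

/-- The free product of a subshift `V ⊆ B^G` and a subshift `W ⊆ B^H`, a subshift
of `B^(G∗H)`. -/
def freeProd {G H B : Type} [Group G] [Group H]
    (V : Set (G → B)) (W : Set (H → B)) : Set (Monoid.Coprod G H → B) :=
  {x | ∀ g : Monoid.Coprod G H,
    (fun h : G => x (g * Monoid.Coprod.inl h)) ∈ V ∧
    (fun k : H => x (g * Monoid.Coprod.inr k)) ∈ W}

theorem Subgroup.fg_of_le_fg {C : Type*} [CommGroup C] {A B : Subgroup C} (hA : A.FG)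
    (hBA : B ≤ A) : B.FG := by
  rw [Subgroup.fg_iff_add_fg] at *
  have hA' : (AddSubgroup.toIntSubmodule (Subgroup.toAddSubgroup A)).FG :=
    (Submodule.fg_iff_addSubgroup_fg _).2 (by simpa using hA)
  have : (AddSubgroup.toIntSubmodule (Subgroup.toAddSubgroup B)).FG := hA'.of_le hBA
  simpa using (Submodule.fg_iff_addSubgroup_fg _).1 this

theorem Subgroup.normalClosure_eq_closure_of_le_center {G : Type*} [Group G] {S : Set G}
    (hS : S ⊆ Subgroup.center G) : Subgroup.normalClosure S = Subgroup.closure S := by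
  have hle : Subgroup.closure S ≤ Subgroup.center G := (Subgroup.closure_le _).2 hS
  have : (Subgroup.closure S).Normal := by
    refine ⟨fun n hn g => ?_⟩
    rw [Subgroup.mem_center_iff.1 (hle hn) g]
    simpa using hn
  exact le_antisymm (Subgroup.normalClosure_le_normal Subgroup.subset_closure)
    Subgroup.closure_le_normalClosure

theorem Subgroup.IsFinitelyNormallyGenerated.fg_of_le_center {G : Type*} [Group G]
    {N : Subgroup G} (hN : N.IsFinitelyNormallyGenerated) (hc : N ≤ Subgroup.center G) :
    N.FG := by
  obtain ⟨S, hS, rfl⟩ := hN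
  rw [Subgroup.normalClosure_eq_closure_of_le_center
    (Subgroup.subset_normalClosure.trans hc)]
  exact (Subgroup.fg_iff _).2 ⟨S, rfl, hS⟩

/-- A subgroup of a finitely generated central subgroup is finitely generated. -/
theorem Subgroup.fg_of_le_fg_of_le_center {G : Type*} [Group G] {A B : Subgroup G} (hA : A.FG)
    (hc : A ≤ Subgroup.center G) (hBA : B ≤ A) : B.FG := by
  let _ : CommGroup A :=
    { (inferInstance : Group A) with
      mul_comm := fun a b => Subtype.ext (Subgroup.mem_center_iff.1 (hc b.2) a) }
  have hA' : (⊤ : Subgroup A).FG := Group.fg_def.1 ((Group.fg_iff_subgroup_fg A).2 hA)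
  have hB' : (B.subgroupOf A).FG := Subgroup.fg_of_le_fg hA' le_top
  have := (Group.fg_iff_subgroup_fg _).2 hB'
  rw [← Group.fg_iff_subgroup_fg]
  exact Group.fg_of_surjective (Subgroup.subgroupOfEquivOfLe hBA).surjective
    (f := (Subgroup.subgroupOfEquivOfLe hBA).toMonoidHom)

/-- Finitely generated nilpotent groups are finitely presented with respect to any finite
generating tuple. -/
theorem Group.IsNilpotent.ker_isFinitelyNormallyGenerated (G : Type*) [Group G]
    [Group.IsNilpotent G] {n : ℕ} (φ : FreeGroup (Fin n) →* G) (hφ : Function.Surjective φ) :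
    φ.ker.IsFinitelyNormallyGenerated := by
  refine Group.nilpotent_center_quotient_ind (P := fun G _ _ =>
    ∀ φ : FreeGroup (Fin n) →* G, Function.Surjective φ → φ.ker.IsFinitelyNormallyGenerated)
    G ?_ ?_ φ hφ
  · intro G _ _ φ _
    have : φ.ker = ⊤ := by
      ext x; simpa using Subsingleton.elim _ _
    rw [this]
    have : Group.FG (⊤ : Subgroup (FreeGroup (Fin n))) :=
      (Group.fg_iff_subgroup_fg _).2 (Group.fg_def.1 inferInstance)
    exact Subgroup.IsFinitelyNormallyGenerated.of_FG _
  · clear hφ φ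
    intro G _ _ ih φ hφ
    obtain ⟨S, hSfin, hS⟩ := ih ((QuotientGroup.mk' (Subgroup.center G)).comp φ)
      ((QuotientGroup.mk'_surjective _).comp hφ)
    have hScen : ∀ s ∈ S, φ s ∈ Subgroup.center G := by
      intro s hs
      have : s ∈ ((QuotientGroup.mk' (Subgroup.center G)).comp φ).ker :=
        hS ▸ Subgroup.subset_normalClosure hs
      simpa [MonoidHom.mem_ker] using this
    set T : Set (FreeGroup (Fin n)) :=
      (fun p : FreeGroup (Fin n) × Fin n => p.1 * FreeGroup.of p.2 * p.1⁻¹ *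
        (FreeGroup.of p.2)⁻¹) '' (S ×ˢ Set.univ) with hT
    have hTfin : T.Finite := (hSfin.prod Set.finite_univ).image _
    have hTker : T ⊆ φ.ker := by
      rintro _ ⟨⟨s, i⟩, ⟨hs, -⟩, rfl⟩
      simp only [SetLike.mem_coe, MonoidHom.mem_ker, map_mul, map_inv]
      rw [← Subgroup.mem_center_iff.1 (hScen s hs)]
      group
    set N := Subgroup.normalClosure T with hN
    have hNker : N ≤ φ.ker := Subgroup.normalClosure_le_normal hTker
    set π := QuotientGroup.mk' N with hπ
    have hπs : Function.Surjective π := QuotientGroup.mk'_surjective _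
    have hcen : π '' S ⊆ Subgroup.center (FreeGroup (Fin n) ⧸ N) := by
      rintro _ ⟨s, hs, rfl⟩
      have : Subgroup.map π ⊤ ≤ Subgroup.centralizer {π s} := by
        rw [← FreeGroup.closure_range_of, MonoidHom.map_closure, Subgroup.closure_le]
        rintro _ ⟨_, ⟨i, rfl⟩, rfl⟩
        simp only [SetLike.mem_coe, Subgroup.mem_centralizer_singleton_iff]
        have h1 : π (s * FreeGroup.of i * s⁻¹ * (FreeGroup.of i)⁻¹) = 1 := by
          rw [hπ, QuotientGroup.mk'_apply, QuotientGroup.eq_one_iff]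
          exact Subgroup.subset_normalClosure ⟨(s, i), ⟨hs, trivial⟩, rfl⟩
        rw [map_mul, map_mul, map_mul, map_inv, map_inv, mul_inv_eq_one,
          mul_inv_eq_iff_eq_mul] at h1
        exact h1.symm
      rw [SetLike.mem_coe, Subgroup.mem_center_iff]
      intro g
      obtain ⟨g, rfl⟩ := hπs g
      have := this (Subgroup.mem_map_of_mem π (Subgroup.mem_top g))
      rw [Subgroup.mem_centralizer_singleton_iff] at this
      exact this
    have hfg : (φ.ker.map π).FG := by
      refine Subgroup.fg_of_le_fg_of_le_center (A := Subgroup.closure (π '' S))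
        ((Subgroup.fg_iff _).2 ⟨_, rfl, hSfin.image _⟩) ((Subgroup.closure_le _).2 hcen) ?_
      rw [← Subgroup.normalClosure_eq_closure_of_le_center hcen,
        ← Subgroup.map_normalClosure _ _ hπs, hS]
      refine Subgroup.map_mono fun x hx => ?_
      rw [MonoidHom.mem_ker] at *
      simp [hx]
    have hnormal : (φ.ker.map π).Normal := Subgroup.Normal.map inferInstance _ hπs
    have := (Group.fg_iff_subgroup_fg _).2 hfg
    have h2 := (Subgroup.IsFinitelyNormallyGenerated.of_FG (φ.ker.map π)).comap hπs
      ⟨T, hTfin, by rw [hπ, QuotientGroup.ker_mk']⟩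
    rwa [Subgroup.comap_map_eq, hπ, QuotientGroup.ker_mk', sup_eq_left.2 hNker] at h2

theorem Group.IsNilpotent.center_fg (G : Type*) [Group G] [Group.IsNilpotent G]
    [hG : Group.FG G] : (Subgroup.center G).FG := by
  obtain ⟨ι, hι, φ, hφ⟩ := Group.fg_iff_exists_freeGroup_hom_surjective_finite.1 hG
  obtain ⟨n, ⟨e⟩⟩ := Finite.exists_equiv_fin ι
  have hψ : Function.Surjective (φ.comp (FreeGroup.freeGroupCongr e).symm.toMonoidHom) :=
    hφ.comp (FreeGroup.freeGroupCongr e).symm.surjective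
  have h := (Group.IsNilpotent.ker_isFinitelyNormallyGenerated _
    ((QuotientGroup.mk' (Subgroup.center G)).comp (φ.comp
      (FreeGroup.freeGroupCongr e).symm.toMonoidHom))
    ((QuotientGroup.mk'_surjective _).comp hψ)).map hψ
  rw [← MonoidHom.comap_ker, Subgroup.map_comap_eq_self_of_surjective hψ,
    QuotientGroup.ker_mk'] at h
  exact h.fg_of_le_center le_rfl

theorem Group.finite_of_finite_center_of_finite_quotient (G : Type*) [Group G]
    [Finite (Subgroup.center G)] [Finite (G ⧸ Subgroup.center G)] : Finite G :=
  Finite.of_equiv _ (Subgroup.groupEquivQuotientProdSubgroup (s := Subgroup.center G)).symm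

theorem Group.IsNilpotent.finite_center (G : Type*) [Group G] [Group.IsNilpotent G]
    [hG : Group.FG G] (h : ∀ g ∈ Subgroup.center G, IsOfFinOrder g) :
    Finite (Subgroup.center G) := by
  have := (Group.fg_iff_subgroup_fg _).2 (Group.IsNilpotent.center_fg G)
  let _ : CommGroup (Subgroup.center G) :=
    { (inferInstance : Group (Subgroup.center G)) with
      mul_comm := fun a b => Subtype.ext (Subgroup.mem_center_iff.1 b.2 a) }
  exact CommGroup.finite_of_fg_isMulTorsion (Subgroup.center G) fun g =>
    Submonoid.isOfFinOrder_coe.1 (h g.1 g.2)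

theorem Group.IsNilpotent.finite_of_fg_of_isOfFinOrder (G : Type*) [Group G]
    [Group.IsNilpotent G] [hG : Group.FG G] (h : ∀ g : G, IsOfFinOrder g) : Finite G := by
  refine Group.nilpotent_center_quotient_ind (P := fun G _ _ =>
    Group.FG G → (∀ g : G, IsOfFinOrder g) → Finite G) G ?_ ?_ hG h
  · intro G _ _ _ _
    infer_instance
  · clear h hG
    intro G _ _ ih hG h
    have hfin : Finite (G ⧸ Subgroup.center G) := by
      refine ih inferInstance fun g => ?_
      obtain ⟨g, rfl⟩ := QuotientGroup.mk'_surjective (Subgroup.center G) g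
      exact MonoidHom.isOfFinOrder _ (h g)
    have : Finite (Subgroup.center G) := Group.IsNilpotent.finite_center G fun g _ => h g
    exact Group.finite_of_finite_center_of_finite_quotient G

/-- A finitely generated nilpotent group which is not virtually cyclic contains a free abelian
subgroup of rank two. -/
theorem Group.IsNilpotent.exists_free_abelian_pair (G : Type*) [Group G]
    [Group.IsNilpotent G] [hG : Group.FG G]
    (hnvc : ∀ H : Subgroup G, H.index ≠ 0 → ¬ IsCyclic H) :
    ∃ a b : G, a * b = b * a ∧ ∀ i j : ℤ, a ^ i * b ^ j = 1 → i = 0 ∧ j = 0 := by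
  refine Group.nilpotent_center_quotient_ind (P := fun G _ _ =>
    Group.FG G → (∀ H : Subgroup G, H.index ≠ 0 → ¬ IsCyclic H) →
      ∃ a b : G, a * b = b * a ∧ ∀ i j : ℤ, a ^ i * b ^ j = 1 → i = 0 ∧ j = 0) G ?_ ?_ hG hnvc
  · intro G _ _ _ h
    exact absurd (inferInstance : IsCyclic (⊥ : Subgroup G))
      (h ⊥ (by simp [Subgroup.index_bot]))
  clear hnvc hG
  intro G _ _ ih hG hnvc
  by_cases hz : ∃ z ∈ Subgroup.center G, ¬ IsOfFinOrder z
  · obtain ⟨z, hzc, hz⟩ := hz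
    have hn : (Subgroup.zpowers z).Normal := by
      refine ⟨fun n hn g => ?_⟩
      obtain ⟨k, rfl⟩ := Subgroup.mem_zpowers_iff.1 hn
      rw [Subgroup.mem_center_iff.1 (Subgroup.zpow_mem _ hzc k) g]
      simp
    have hinf : ¬ Finite (G ⧸ Subgroup.zpowers z) := fun hf =>
      hnvc (Subgroup.zpowers z) Subgroup.index_ne_zero_of_finite inferInstance
    have hb : ∃ b : G ⧸ Subgroup.zpowers z, ¬ IsOfFinOrder b := by
      by_contra! hcon
      exact hinf (Group.IsNilpotent.finite_of_fg_of_isOfFinOrder _ hcon)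
    obtain ⟨b, hb⟩ := hb
    obtain ⟨b, rfl⟩ := QuotientGroup.mk'_surjective _ b
    refine ⟨z, b, (Subgroup.mem_center_iff.1 hzc b).symm, fun i j hij => ?_⟩
    have hj : j = 0 := by
      by_contra hj
      apply hb
      rw [isOfFinOrder_iff_zpow_eq_one]
      refine ⟨j, hj, ?_⟩
      rw [← map_zpow, QuotientGroup.mk'_apply, QuotientGroup.eq_one_iff,
        ← inv_mem_iff, ← eq_inv_of_mul_eq_one_left hij]
      exact Subgroup.zpow_mem_zpowers z i
    subst hj
    refine ⟨?_, rfl⟩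
    by_contra hi
    exact hz (isOfFinOrder_iff_zpow_eq_one.2 ⟨i, hi, by simpa using hij⟩)
  · push Not at hz
    have hfin := Group.IsNilpotent.finite_center G hz
    obtain ⟨a, b, hab, h⟩ := ih inferInstance (by
      intro H hH hcyc
      obtain ⟨⟨t, ht⟩, hgen⟩ := hcyc
      obtain ⟨t, rfl⟩ := QuotientGroup.mk'_surjective _ t
      refine hnvc (Subgroup.zpowers t) ?_ inferInstance
      have hmap : (Subgroup.zpowers t).map (QuotientGroup.mk' (Subgroup.center G)) = H := by
        apply le_antisymm
        · rw [MonoidHom.map_zpowers]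
          exact Subgroup.zpowers_le.2 ht
        · intro x hx
          obtain ⟨k, hk⟩ := Subgroup.mem_zpowers_iff.1 (hgen ⟨x, hx⟩)
          refine ⟨t ^ k, Subgroup.zpow_mem_zpowers t k, ?_⟩
          rw [map_zpow]
          exact congrArg Subtype.val hk
      have hidx : (Subgroup.zpowers t ⊔ Subgroup.center G).index ≠ 0 := by
        rw [← hmap, Subgroup.index_map, QuotientGroup.ker_mk'] at hH
        exact left_ne_zero_of_mul hH
      have : (Subgroup.zpowers t ⊔ Subgroup.center G).FiniteIndex := ⟨hidx⟩
      have : Finite (G ⧸ Subgroup.zpowers t) := by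
        refine Finite.of_surjective
          (fun p : (G ⧸ (Subgroup.zpowers t ⊔ Subgroup.center G)) × Subgroup.center G =>
            (QuotientGroup.mk (p.1.out * p.2.1) : G ⧸ Subgroup.zpowers t)) fun x => ?_
        induction x using QuotientGroup.induction_on with
        | H x =>
        set q : G ⧸ (Subgroup.zpowers t ⊔ Subgroup.center G) := QuotientGroup.mk x with hq
        have hmem : q.out⁻¹ * x ∈ Subgroup.zpowers t ⊔ Subgroup.center G := by
          rw [← QuotientGroup.eq, QuotientGroup.out_eq']
        obtain ⟨y, hy, z, hz', hyz⟩ := Subgroup.mem_sup_of_normal_right.1 hmem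
        refine ⟨(q, ⟨z, hz'⟩), ?_⟩
        simp only
        rw [QuotientGroup.eq]
        have : (q.out * z)⁻¹ * x = y := by
          rw [mul_inv_rev, mul_assoc, ← hyz, ← Subgroup.mem_center_iff.1 (inv_mem hz') (y * z)]
          simp
        rwa [this]
      exact Subgroup.index_ne_zero_of_finite)
    obtain ⟨a, rfl⟩ := QuotientGroup.mk'_surjective (Subgroup.center G) a
    obtain ⟨b, rfl⟩ := QuotientGroup.mk'_surjective (Subgroup.center G) b
    set c := a * b * a⁻¹ * b⁻¹ with hc
    have hcz : c ∈ Subgroup.center G := by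
      rw [← QuotientGroup.eq_one_iff, ← QuotientGroup.mk'_apply, hc]
      simp only [map_mul, map_inv]
      rw [hab]
      group
    obtain ⟨m, hm, hcm⟩ := (isOfFinOrder_iff_pow_eq_one).1 (hz c hcz)
    have hconj : b * a * b⁻¹ = c⁻¹ * a := by
      rw [hc]; group
    have hpow : b * a ^ m * b⁻¹ = a ^ m := by
      have hcomm : Commute c⁻¹ a := (Subgroup.mem_center_iff.1 (inv_mem hcz) a).symm
      rw [← conj_pow, hconj, hcomm.mul_pow, inv_pow, hcm, inv_one, one_mul]
    refine ⟨a ^ m, b, (mul_inv_eq_iff_eq_mul.1 hpow).symm, fun i j hij => ?_⟩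
    have h1 := congrArg (QuotientGroup.mk' (Subgroup.center G)) hij
    rw [map_mul, map_zpow, map_zpow, map_pow, map_one, ← zpow_natCast, ← zpow_mul] at h1
    obtain ⟨h2, h3⟩ := h _ _ h1
    refine ⟨?_, h3⟩
    rcases mul_eq_zero.1 h2 with h4 | h4
    · omega
    · exact h4

/-- Elementary operations on a stack. -/
inductive StackOp (Γ : Type) : Type
  | noop : StackOp Γ
  | push : Γ → StackOp Γ
  | pop : StackOp Γ
  | clear : StackOp Γ

/-- The effect of an operation on a stack. -/
def StackOp.apply {Γ : Type} : StackOp Γ → List Γ → List Γ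
  | .noop, l => l
  | .push a, l => a :: l
  | .pop, l => l.tail
  | .clear, _ => []

/-- A deterministic machine with finitely many stacks, which at each step may emit a bit. -/
structure StackMachine (Q K Γ : Type) where
  /-- the initial state -/
  init : Q
  /-- the new state, given the old one and the tops of the stacks -/
  next : Q → (K → Option Γ) → Q
  /-- the operations performed on the stacks -/
  op : Q → (K → Option Γ) → K → StackOp Γ
  /-- the bit emitted -/
  emit : Q → (K → Option Γ) → Option Bool
  /-- the stack used as a unary counter -/
  counter : K

namespace StackMachine

variable {Q K Γ : Type} (M : StackMachine Q K Γ)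

/-- One step of a stack machine. -/
def step (c : Q × (K → List Γ)) : Q × (K → List Γ) :=
  (M.next c.1 fun k => (c.2 k).head?, fun k => (M.op c.1 (fun k => (c.2 k).head?) k).apply (c.2 k))

/-- The configuration after `j` steps, started on empty stacks. -/
def run (j : ℕ) : Q × (K → List Γ) := M.step^[j] (M.init, fun _ => [])

/-- The bit `b` is emitted when the counter has value `n`. -/
def Emits (n : ℕ) (b : Bool) : Prop :=
  ∃ j, M.emit (M.run j).1 (fun k => ((M.run j).2 k).head?) = some b ∧
    ((M.run j).2 M.counter).length = n

/-- The tiles used to draw the space-time diagram of a stack machine. -/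
structure Tile (Q K Γ : Type) where
  /-- lies in the first row -/
  first : Bool
  /-- lies in the first column -/
  col : Bool
  /-- the state, constant along rows -/
  state : Q
  /-- the tops of the stacks, constant along rows -/
  tops : K → Option Γ
  /-- the stack symbols at this position -/
  sym : K → Option Γ
  /-- a bit, constant along columns -/
  bit : Bool

/-- The tile at the origin. -/
def seed : Tile Q K Γ := ⟨true, true, M.init, fun _ => none, fun _ => none, true⟩

/-- The local rule: `c` has right neighbour `r`, upper neighbour `u`, and `w` lies above `r`. -/
structure Rule (c r u w : Tile Q K Γ) : Prop where
  first : c.first = true → r.first = true ∧ c.state = M.init ∧ ∀ k, c.sym k = none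
  col : c.col = true → u.col = true ∧ c.tops = c.sym ∧
    ∀ k a, M.op c.state c.tops k = .push a → u.sym k = some a
  state_right : r.state = c.state
  tops_right : r.tops = c.tops
  bit_up : u.bit = c.bit
  state_up : u.state = M.next c.state c.tops
  noop : ∀ k, M.op c.state c.tops k = .noop → u.sym k = c.sym k
  push : ∀ k a, M.op c.state c.tops k = .push a → w.sym k = c.sym k
  pop : ∀ k, M.op c.state c.tops k = .pop → u.sym k = r.sym k
  clear : ∀ k, M.op c.state c.tops k = .clear → u.sym k = none
  emit_zero : ∀ b, M.emit c.state c.tops = some b → c.col = true → c.sym M.counter = none →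
    c.bit ≠ b
  emit_succ : ∀ b, M.emit c.state c.tops = some b → c.sym M.counter ≠ none →
    r.sym M.counter = none → r.bit ≠ b

theorem run_succ (j : ℕ) : M.run (j + 1) = M.step (M.run j) := Function.iterate_succ_apply' _ _ _

/-- The space-time diagram. -/
def diagram (X : ℕ → Bool) (i j : ℕ) : Tile Q K Γ :=
  ⟨j = 0, i = 0, (M.run j).1, fun k => ((M.run j).2 k).head?, fun k => ((M.run j).2 k)[i]?, X i⟩

theorem rule_diagram {X : ℕ → Bool} (hX : ∀ n b, M.Emits n b → X n ≠ b) (i j : ℕ) :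
    M.Rule (M.diagram X i j) (M.diagram X (i + 1) j) (M.diagram X i (j + 1))
      (M.diagram X (i + 1) (j + 1)) where
  first h := by
    have : j = 0 := by simpa [diagram] using h
    subst this
    simp [diagram, run]
  col h := by
    have : i = 0 := by simpa [diagram] using h
    subst this
    refine ⟨by simp [diagram], by simp [diagram, List.head?_eq_getElem?], fun k a h => ?_⟩
    simp only [diagram] at h
    simp [diagram, run_succ, step, h, StackOp.apply]
  state_right := rfl
  tops_right := rfl
  bit_up := rfl
  state_up := by simp [diagram, run_succ, step]
  noop k h := by
    simp only [diagram] at h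
    simp [diagram, run_succ, step, h, StackOp.apply]
  push k a h := by
    simp only [diagram] at h
    simp [diagram, run_succ, step, h, StackOp.apply]
  pop k h := by
    simp only [diagram] at h
    simp [diagram, run_succ, step, h, StackOp.apply]
  clear k h := by
    simp only [diagram] at h
    simp [diagram, run_succ, step, h, StackOp.apply]
  emit_zero b h hc hs := by
    have : i = 0 := by simpa [diagram] using hc
    subst this
    refine hX 0 b ⟨j, h, ?_⟩
    simpa [diagram] using hs
  emit_succ b h hs hr := by
    refine hX (i + 1) b ⟨j, h, ?_⟩
    simp only [diagram, ne_eq, List.getElem?_eq_none_iff] at hs hr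
    omega

theorem seed_eq_diagram {X : ℕ → Bool} (hX : X 0 = true) : M.diagram X 0 0 = M.seed := by
  simp [diagram, seed, run, hX]

section Forward

variable {M} {x : ℕ → ℕ → Tile Q K Γ}

theorem bit_eq_of_rule
    (hx : ∀ i j, M.Rule (x i j) (x (i + 1) j) (x i (j + 1)) (x (i + 1) (j + 1)))
    (i j : ℕ) : (x i j).bit = (x i 0).bit := by
  induction j with
  | zero => rfl
  | succ j ih => rw [(hx i j).bit_up, ih]

theorem col_of_rule (h0 : x 0 0 = M.seed)
    (hx : ∀ i j, M.Rule (x i j) (x (i + 1) j) (x i (j + 1)) (x (i + 1) (j + 1)))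
    (j : ℕ) : (x 0 j).col = true := by
  induction j with
  | zero => rw [h0]; rfl
  | succ j ih => exact ((hx 0 j).col ih).1

theorem first_of_rule (h0 : x 0 0 = M.seed)
    (hx : ∀ i j, M.Rule (x i j) (x (i + 1) j) (x i (j + 1)) (x (i + 1) (j + 1)))
    (i : ℕ) : (x i 0).first = true := by
  induction i with
  | zero => rw [h0]; rfl
  | succ i ih => exact ((hx i 0).first ih).1

theorem state_tops_of_rule
    (hx : ∀ i j, M.Rule (x i j) (x (i + 1) j) (x i (j + 1)) (x (i + 1) (j + 1)))
    (i j : ℕ) :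
    (x i j).state = (x 0 j).state ∧ (x i j).tops = (x 0 j).tops := by
  induction i with
  | zero => exact ⟨rfl, rfl⟩
  | succ i ih => rw [(hx i j).state_right, (hx i j).tops_right]; exact ih

theorem eq_run_of_rule (h0 : x 0 0 = M.seed)
    (hx : ∀ i j, M.Rule (x i j) (x (i + 1) j) (x i (j + 1)) (x (i + 1) (j + 1)))
    (j : ℕ) : ∀ i, (x i j).state = (M.run j).1 ∧
    (x i j).tops = (fun k => ((M.run j).2 k).head?) ∧
    (x i j).sym = fun k => ((M.run j).2 k)[i]? := by
  have key : ∀ i j, (x i j).tops = (fun k => (x 0 j).sym k) := fun i j => by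
    rw [(state_tops_of_rule hx i j).2, ((hx 0 j).col (col_of_rule h0 hx j)).2.1]
  induction j with
  | zero =>
    intro i
    have hs : ∀ i, (x i 0).sym = fun _ => none := fun i =>
      funext ((hx i 0).first (first_of_rule h0 hx i)).2.2
    refine ⟨((hx i 0).first (first_of_rule h0 hx i)).2.1, ?_, ?_⟩
    · rw [key, hs]; rfl
    · rw [hs]; simp [run]
  | succ j ih =>
    have hs : ∀ i, (x i (j + 1)).sym = fun k => ((M.run (j + 1)).2 k)[i]? := by
      intro i
      funext k
      obtain ⟨h1, h2, h3⟩ := ih i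
      rw [run_succ, step]
      simp only
      cases hop : M.op (M.run j).1 (fun k => ((M.run j).2 k).head?) k with
      | noop => rw [(hx i j).noop k (by rw [h1, h2, hop]), h3]; rfl
      | push a =>
        cases i with
        | zero =>
          rw [((hx 0 j).col (col_of_rule h0 hx j)).2.2 k a (by rw [h1, h2, hop])]
          simp [StackOp.apply]
        | succ i =>
          obtain ⟨h1, h2, h3⟩ := ih i
          rw [(hx i j).push k a (by rw [h1, h2, hop]), h3]
          simp [StackOp.apply]
      | pop =>
        rw [(hx i j).pop k (by rw [h1, h2, hop]), (ih (i + 1)).2.2]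
        simp [StackOp.apply]
      | clear =>
        rw [(hx i j).clear k (by rw [h1, h2, hop])]
        simp [StackOp.apply]
    intro i
    refine ⟨?_, ?_, hs i⟩
    · rw [(hx i j).state_up, (ih i).1, (ih i).2.1, run_succ, step]
    · rw [key, hs]
      funext k
      rw [List.head?_eq_getElem?]

theorem bit_ne_of_emits (h0 : x 0 0 = M.seed)
    (hx : ∀ i j, M.Rule (x i j) (x (i + 1) j) (x i (j + 1)) (x (i + 1) (j + 1)))
    {n : ℕ} {b : Bool} (h : M.Emits n b) : (x n 0).bit ≠ b := by
  obtain ⟨j, hj, hn⟩ := h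
  cases n with
  | zero =>
    rw [← bit_eq_of_rule hx 0 j]
    obtain ⟨h1, h2, h3⟩ := eq_run_of_rule h0 hx j 0
    refine (hx 0 j).emit_zero b (by rw [h1, h2, hj]) (col_of_rule h0 hx j) ?_
    rw [h3]
    simpa using hn
  | succ n =>
    rw [← bit_eq_of_rule hx (n + 1) j]
    obtain ⟨h1, h2, h3⟩ := eq_run_of_rule h0 hx j n
    refine (hx n j).emit_succ b (by rw [h1, h2, hj]) ?_ ?_
    · rw [h3]
      simp only [ne_eq, List.getElem?_eq_none_iff]
      omega
    · rw [(eq_run_of_rule h0 hx j (n + 1)).2.2]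
      simp only [List.getElem?_eq_none_iff]
      omega

end Forward

end StackMachine

namespace Turing.PartrecToTM2

open Turing TM2

/-- The state after a statement, given the tops of the stacks; halting restarts the computation
at `l`. -/
def driverNext (l : Λ') : Stmt (fun _ : K' => Γ') Λ' (Option Γ') × Option Γ' →
    (Option K' → Option Γ') → Stmt (fun _ : K' => Γ') Λ' (Option Γ') × Option Γ'
  | (.push _ _ q, v), _ => (q, v)
  | (.peek k f q, v), t => (q, f v (t (some k)))
  | (.pop k f q, v), t => (q, f v (t (some k)))
  | (.load a q, v), _ => (q, a v)
  | (.branch p q₁ q₂, v), _ => (cond (p v) q₁ q₂, v)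
  | (.goto f, v), _ => (tr (f v), v)
  | (.halt, _), _ => (tr l, none)

/-- The stack operations of a statement. Upon halting, the counter is incremented if the first
number on the main stack is zero, and reset otherwise. -/
def driverOp : Stmt (fun _ : K' => Γ') Λ' (Option Γ') × Option Γ' →
    (Option K' → Option Γ') → Option K' → StackOp Γ'
  | (.push k f _, v), _, some k' => if k' = k then .push (f v) else .noop
  | (.pop k _ _, _), _, some k' => if k' = k then .pop else .noop
  | (.halt, _), t, none => if t (some .main) = some .cons then .push .cons else .clear
  | _, _, _ => .noop

/-- Upon halting, a bit is emitted according to the first digit on the main stack. -/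
def driverEmit : Stmt (fun _ : K' => Γ') Λ' (Option Γ') × Option Γ' →
    (Option K' → Option Γ') → Option Bool
  | (.halt, _), t => match t (some .main) with
    | some .bit1 => some true
    | some .bit0 => some false
    | _ => none
  | _, _ => none

/-- The stack machine which runs the Turing machine starting at `l` over and over again, feeding
its output back as input. -/
def driver (l : Λ') : StackMachine (Stmt (fun _ : K' => Γ') Λ' (Option Γ') × Option Γ')
    (Option K') Γ' where
  init := (tr l, none)
  next := driverNext l
  op := driverOp
  emit := driverEmit
  counter := none

/-- The configuration of the driver simulating a given configuration. -/
def driverCfg (U : List Γ') (c : Cfg (fun _ : K' => Γ') Λ' (Option Γ')) :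
    (Stmt (fun _ : K' => Γ') Λ' (Option Γ') × Option Γ') × (Option K' → List Γ') :=
  ((c.l.elim .halt tr, c.var), fun k => k.elim U c.stk)

/-- A step of the driver at a statement other than `halt`. -/
def DriverStep (l : Λ') (c c' : (Stmt (fun _ : K' => Γ') Λ' (Option Γ') × Option Γ') ×
    (Option K' → List Γ')) : Prop :=
  c.1.1 ≠ .halt ∧ (driver l).step c = c'

theorem driverStep_stepAux (l : Λ') (U : List Γ') (q : Stmt (fun _ : K' => Γ') Λ' (Option Γ'))
    (v : Option Γ') (S : K' → List Γ') :
    Relation.ReflTransGen (DriverStep l) ((q, v), fun k => k.elim U S)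
      (driverCfg U (stepAux q v S)) := by
  induction q generalizing v S with
  | push k f q ih =>
    refine .head ⟨by simp, ?_⟩ (ih _ _)
    refine Prod.ext rfl (funext fun k' => ?_)
    rcases k' with _ | k'
    · rfl
    · by_cases h : k' = k
      · subst h
        simp [StackMachine.step, driver, driverOp, StackOp.apply]
      · simp [StackMachine.step, driver, driverOp, StackOp.apply, h]
  | pop k f q ih =>
    refine .head ⟨by simp, ?_⟩ (ih _ _)
    refine Prod.ext rfl (funext fun k' => ?_)
    rcases k' with _ | k'
    · rfl
    · by_cases h : k' = k
      · subst h
        simp [StackMachine.step, driver, driverOp, StackOp.apply]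
      · simp [StackMachine.step, driver, driverOp, StackOp.apply, h]
  | peek k f q ih =>
    refine .head ⟨by simp, ?_⟩ (ih _ _)
    refine Prod.ext rfl (funext fun k' => ?_)
    rcases k' with _ | k' <;> rfl
  | load a q ih =>
    refine .head ⟨by simp, ?_⟩ (ih _ _)
    refine Prod.ext rfl (funext fun k' => ?_)
    rcases k' with _ | k' <;> rfl
  | branch p q₁ q₂ ih₁ ih₂ =>
    refine .head (b := ((cond (p v) q₁ q₂, v), fun k => k.elim U S)) ⟨by simp, ?_⟩ ?_
    · refine Prod.ext rfl (funext fun k' => ?_)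
      rcases k' with _ | k' <;> rfl
    · cases h : p v
      · simpa [h] using ih₂ v S
      · simpa [h] using ih₁ v S
  | goto f =>
    refine .single ⟨by simp, ?_⟩
    refine Prod.ext rfl (funext fun k' => ?_)
    rcases k' with _ | k' <;> rfl
  | halt => exact .refl

theorem driverStep_of_reaches (l : Λ') (U : List Γ')
    {c c' : Cfg (fun _ : K' => Γ') Λ' (Option Γ')}
    (h : StateTransition.Reaches (TM2.step tr) c c') :
    Relation.ReflTransGen (DriverStep l) (driverCfg U c) (driverCfg U c') := by
  induction h with
  | refl => exact .refl
  | @tail b d _ h2 ih =>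
    refine ih.trans ?_
    obtain ⟨_ | l', v, S⟩ := b
    · cases h2
    · obtain rfl : stepAux (tr l') v S = d := Option.some.inj h2
      exact driverStep_stepAux l U (tr l') v S

theorem driver_run_cases {l : Λ'} {A H : ℕ → (Stmt (fun _ : K' => Γ') Λ' (Option Γ') × Option Γ') ×
    (Option K' → List Γ')} (h0 : A 0 = (driver l).run 0)
    (hAH : ∀ m, Relation.ReflTransGen (DriverStep l) (A m) (H m))
    (hHA : ∀ m, (driver l).step (H m) = A (m + 1)) :
    (∀ m, ∃ j, (driver l).run j = H m) ∧
      ∀ j, ((driver l).run j).1.1 = .halt → ∃ m, (driver l).run j = H m := by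
  constructor
  · have key : ∀ c c', Relation.ReflTransGen (DriverStep l) c c' →
        (∃ j, (driver l).run j = c) → ∃ j, (driver l).run j = c' := by
      intro c c' h hc
      induction h with
      | refl => exact hc
      | tail _ h2 ih =>
        obtain ⟨j, rfl⟩ := ih
        exact ⟨j + 1, by rw [StackMachine.run_succ, h2.2]⟩
    have hA : ∀ m, ∃ j, (driver l).run j = A m := by
      intro m
      induction m with
      | zero => exact ⟨0, h0.symm⟩
      | succ m ih =>
        obtain ⟨j, hj⟩ := key _ _ (hAH m) ih
        exact ⟨j + 1, by rw [StackMachine.run_succ, hj, hHA]⟩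
    exact fun m => key _ _ (hAH m) (hA m)
  · have inv : ∀ j, ∃ m, Relation.ReflTransGen (DriverStep l) ((driver l).run j) (H m) := by
      intro j
      induction j with
      | zero => exact ⟨0, h0 ▸ hAH 0⟩
      | succ j ih =>
        obtain ⟨m, hm⟩ := ih
        rw [StackMachine.run_succ]
        rcases Relation.ReflTransGen.cases_head hm with h | ⟨c, h1, h2⟩
        · exact ⟨m + 1, by rw [h, hHA]; exact hAH _⟩
        · exact ⟨m, by rw [h1.2]; exact h2⟩
    intro j hj
    obtain ⟨m, hm⟩ := inv j
    rcases Relation.ReflTransGen.cases_head hm with h | ⟨c, h1, h2⟩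
    · exact ⟨m, h⟩
    · exact absurd hj h1.1

/-- The driver visits only finitely many states. -/
theorem finite_driver_states (c : ToPartrec.Code) :
    ∃ F : Set (Stmt (fun _ : K' => Γ') Λ' (Option Γ') × Option Γ'), F.Finite ∧
      ∀ j, ((driver (trNormal c .halt)).run j).1 ∈ F := by
  let _ : Inhabited Λ' := ⟨trNormal c .halt⟩
  set S := codeSupp c .halt
  have ss : TM2.Supports tr S := tr_supports c .halt
  have htr : ∀ l ∈ S, some (tr l) ∈ stmts tr S := by
    intro l hl
    classical exact Finset.some_mem_insertNone.2 (Finset.mem_biUnion.2 ⟨l, hl, stmts₁_self⟩)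
  refine ⟨{p | some p.1 ∈ stmts tr S}, ?_, fun j => ?_⟩
  · have h1 : {s : Stmt (fun _ : K' => Γ') Λ' (Option Γ') | some s ∈ stmts tr S}.Finite :=
      (Finset.finite_toSet (stmts tr S)).preimage (Option.some_injective _).injOn
    refine (h1.prod (Set.toFinite (Set.univ : Set (Option Γ')))).subset fun p hp => ⟨hp, trivial⟩
  · induction j with
    | zero => exact htr _ ss.1
    | succ j ih =>
      rw [StackMachine.run_succ]
      revert ih
      generalize (driver (trNormal c .halt)).run j = r
      obtain ⟨⟨q, v⟩, T⟩ := r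
      intro ih
      have ih : some q ∈ stmts tr S := ih
      have hs := stmts_supportsStmt ss ih
      cases q with
      | push k f q => exact stmts_trans (q₁ := q) (by classical simp [stmts₁, stmts₁_self]) ih
      | peek k f q => exact stmts_trans (q₁ := q) (by classical simp [stmts₁, stmts₁_self]) ih
      | pop k f q => exact stmts_trans (q₁ := q) (by classical simp [stmts₁, stmts₁_self]) ih
      | load f q => exact stmts_trans (q₁ := q) (by classical simp [stmts₁, stmts₁_self]) ih
      | branch p q₁ q₂ =>
        refine stmts_trans (q₁ := cond (p v) q₁ q₂) ?_ ih
        classical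
        cases p v <;> simp [stmts₁, stmts₁_self]
      | goto f => exact htr _ (hs v)
      | halt => exact htr _ ss.1

theorem exists_code_pair {L S : ℕ → ℕ} (hL : Computable L) (hS : Computable S) :
    ∃ c : ToPartrec.Code, ∀ v : List ℕ, c.eval v = pure [L v.tail.headI, S v.tail.headI] := by
  have key : ∀ f : ℕ → ℕ, Computable f → ∃ c : ToPartrec.Code, ∀ n, c.eval [n] = pure [f n] := by
    intro f hf
    have h1 : Nat.Partrec' (n := 1) fun v => (f v.head : Part ℕ) :=
      Nat.Partrec'.part_iff₁.2 hf.partrec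
    obtain ⟨c, hc⟩ := ToPartrec.Code.exists_code h1
    refine ⟨c, fun n => ?_⟩
    have := hc ⟨[n], rfl⟩
    simpa [List.Vector.head] using this
  obtain ⟨cL, hcL⟩ := key L hL
  obtain ⟨cS, hcS⟩ := key S hS
  refine ⟨(ToPartrec.Code.cons cL cS).comp (ToPartrec.Code.head.comp .tail), fun v => ?_⟩
  have h1 : ToPartrec.Code.tail.eval v = Part.some v.tail := by simp
  have h2 : ToPartrec.Code.head.eval v.tail = Part.some [v.tail.headI] := by simp
  have h3 := hcL v.tail.headI
  have h4 := hcS v.tail.headI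
  have h5 : (ToPartrec.Code.head.comp .tail).eval v = Part.some [v.tail.headI] := by
    rw [ToPartrec.Code.comp_eval]
    change (ToPartrec.Code.tail.eval v).bind (fun w => ToPartrec.Code.head.eval w) = _
    rw [h1, Part.bind_some, h2]
  rw [ToPartrec.Code.comp_eval]
  change ((ToPartrec.Code.head.comp .tail).eval v).bind
    (fun w => (ToPartrec.Code.cons cL cS).eval w) = _
  rw [h5, Part.bind_some, ToPartrec.Code.cons_eval]
  change ((cL.eval [v.tail.headI]).bind fun n => (cS.eval [v.tail.headI]).bind fun ns =>
    Part.some (n.headI :: ns)) = _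
  rw [h3, h4]
  change ((Part.some [L v.tail.headI]).bind fun n => (Part.some [S v.tail.headI]).bind fun ns =>
    Part.some (n.headI :: ns)) = _
  rw [Part.bind_some, Part.bind_some]
  rfl

theorem trNat_one : trNat 1 = [.bit1] := by
  simp [trNat, trNum, trPosNum]

theorem trNat_two : trNat 2 = [.bit0, .bit1] := by
  have : ((2 : ℕ) : Num) = .pos (.bit0 .one) := rfl
  rw [trNat, this]
  rfl



/-- The sequence of arguments fed to the driver. -/
def driverArg (S : ℕ → ℕ) (m : ℕ) : ℕ := S^[m] 0

/-- The sequence of values of the counter of the driver. -/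
def driverCount (L S : ℕ → ℕ) : ℕ → ℕ
  | 0 => 0
  | m + 1 => if L (driverArg S m) = 0 then driverCount L S m + 1 else 0

theorem trList_head_zero (n : ℕ) : (trList [0, n]).head? = some .cons := by
  simp

theorem trList_head_one (n : ℕ) : (trList [1, n]).head? = some .bit1 := by
  simp [trNat_one]

theorem trList_head_two (n : ℕ) : (trList [2, n]).head? = some .bit0 := by
  simp [trNat_two]

theorem exists_driver {L S : ℕ → ℕ} (hL : Computable L) (hS : Computable S)
    (hL2 : ∀ s, L s ≤ 2) :
    ∃ c : ToPartrec.Code, ∀ n b, (driver (trNormal c .halt)).Emits n b ↔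
      ∃ m, driverCount L S m = n ∧
        (L (driverArg S m) = 1 ∧ b = true ∨ L (driverArg S m) = 2 ∧ b = false) := by
  obtain ⟨c, hc⟩ := exists_code_pair hL hS
  refine ⟨c, ?_⟩
  set l := trNormal c .halt
  set v : ℕ → List ℕ := fun m => if m = 0 then [] else
    [L (driverArg S (m - 1)), S (driverArg S (m - 1))] with hv
  have hvs : ∀ m, v (m + 1) = [L (driverArg S m), S (driverArg S m)] := fun m => by simp [hv]
  have hvh : ∀ m, (v m).tail.headI = driverArg S m := by
    intro m
    cases m with
    | zero => simp [hv, driverArg]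
    | succ m => simp [hvs, driverArg, Function.iterate_succ_apply']
  set U : ℕ → List Γ' := fun m => List.replicate (driverCount L S m) .cons with hU
  have hreach : ∀ m, Relation.ReflTransGen (DriverStep l) (driverCfg (U m) (init c (v m)))
      (driverCfg (U m) (halt (v (m + 1)))) := by
    intro m
    apply driverStep_of_reaches
    have : halt (v (m + 1)) ∈ StateTransition.eval (TM2.step tr) (init c (v m)) := by
      rw [tr_eval, hc, hvh, hvs]
      exact Part.mem_map_iff _ |>.2 ⟨_, Part.mem_some _, rfl⟩
    exact (StateTransition.mem_eval.1 this).1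
  have hL3 : ∀ s, L s = 0 ∨ L s = 1 ∨ L s = 2 := fun s => by have := hL2 s; omega
  have htops : ∀ m, (fun k => ((driverCfg (U m) (halt (v (m + 1)))).2 k).head?) (some .main) =
      (trList (v (m + 1))).head? := fun m => rfl
  have hstep : ∀ m, (driver l).step (driverCfg (U m) (halt (v (m + 1)))) =
      driverCfg (U (m + 1)) (init c (v (m + 1))) := by
    intro m
    refine Prod.ext rfl (funext fun k => ?_)
    rcases k with _ | k
    · change (if (trList (v (m + 1))).head? = some .cons then StackOp.push Γ'.cons else
        StackOp.clear).apply (U m) = U (m + 1)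
      rw [hvs]
      simp only [hU, driverCount]
      rcases hL3 (driverArg S m) with h | h | h
      · rw [h, trList_head_zero]
        simp [StackOp.apply, List.replicate_succ]
      · rw [h, trList_head_one]
        simp [StackOp.apply]
      · rw [h, trList_head_two]
        simp [StackOp.apply]
    · rfl
  obtain ⟨h1, h2⟩ := driver_run_cases (l := l) (A := fun m => driverCfg (U m) (init c (v m)))
    (H := fun m => driverCfg (U m) (halt (v (m + 1))))
    (by
      refine Prod.ext rfl (funext fun k => ?_)
      rcases k with _ | k
      · rfl
      · cases k <;> rfl) hreach hstep
  have hemit : ∀ m b, (driver l).emit (driverCfg (U m) (halt (v (m + 1)))).1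
      (fun k => ((driverCfg (U m) (halt (v (m + 1)))).2 k).head?) = some b ↔
      (L (driverArg S m) = 1 ∧ b = true ∨ L (driverArg S m) = 2 ∧ b = false) := by
    intro m b
    change (match (trList (v (m + 1))).head? with
      | some .bit1 => some true
      | some .bit0 => some false
      | _ => none) = some b ↔ _
    rw [hvs]
    rcases hL3 (driverArg S m) with h | h | h
    · rw [h, trList_head_zero]
      simp
    · rw [h, trList_head_one]
      simp [eq_comm]
    · rw [h, trList_head_two]
      simp [eq_comm]
  have hlen : ∀ m, ((driverCfg (U m) (halt (v (m + 1)))).2 (driver l).counter).length =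
      driverCount L S m := fun m => by
    change (U m).length = _
    simp [hU]
  intro n b
  constructor
  · rintro ⟨j, hj, hn⟩
    have hhalt : ((driver l).run j).1.1 = .halt := by
      revert hj
      generalize (driver l).run j = r
      obtain ⟨⟨q, w⟩, T⟩ := r
      intro hj
      cases q with
      | halt => rfl
      | _ => exact absurd hj (by simp [driver, driverEmit])
    obtain ⟨m, hm⟩ := h2 j hhalt
    rw [hm] at hj hn
    exact ⟨m, (hlen m).symm.trans hn, (hemit m b).1 hj⟩
  · rintro ⟨m, hm, hb⟩
    obtain ⟨j, hj⟩ := h1 m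
    refine ⟨j, ?_, ?_⟩
    · rw [hj]
      exact (hemit m b).2 hb
    · rw [hj]
      exact (hlen m).trans hm

/-- For computable `p` and `d`, there is a stack machine with finitely many reachable states which
emits precisely the bits `d k` at `p k`. -/
theorem exists_stackMachine_emits {p : ℕ → ℕ} {d : ℕ → Bool} (hp : Computable p)
    (hd : Computable d) :
    ∃ (Q K Γ : Type) (_ : Finite K) (_ : Finite Γ) (M : StackMachine Q K Γ) (F : Set Q),
      F.Finite ∧ (∀ j, (M.run j).1 ∈ F) ∧ ∀ n b, M.Emits n b ↔ ∃ k, p k = n ∧ d k = b := by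
  set L : ℕ → ℕ := fun s => bif decide (s.unpair.2 < p s.unpair.1) then 0 else
    bif d s.unpair.1 then 1 else 2 with hLdef
  set S : ℕ → ℕ := fun s => bif decide (s.unpair.2 < p s.unpair.1) then
    Nat.pair s.unpair.1 (s.unpair.2 + 1) else Nat.pair (s.unpair.1 + 1) 0 with hSdef
  have hu : Computable Nat.unpair := Primrec.unpair.to_comp
  have hu1 : Computable fun s : ℕ => s.unpair.1 := Computable.fst.comp hu
  have hu2 : Computable fun s : ℕ => s.unpair.2 := Computable.snd.comp hu
  have hlt : Computable fun s : ℕ => decide (s.unpair.2 < p s.unpair.1) :=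
    Primrec.nat_lt.decide.to_comp.comp hu2 (hp.comp hu1)
  have hpair : Computable₂ Nat.pair := Primrec₂.natPair.to_comp
  have hL : Computable L := Computable.cond hlt (Computable.const 0)
    (Computable.cond (hd.comp hu1) (Computable.const 1) (Computable.const 2))
  have hS : Computable S := Computable.cond hlt (hpair.comp hu1 (Computable.succ.comp hu2))
    (hpair.comp (Computable.succ.comp hu1) (Computable.const 0))
  have hL2 : ∀ s, L s ≤ 2 := by
    intro s
    simp only [hLdef]
    cases decide (s.unpair.2 < p s.unpair.1) <;> cases d s.unpair.1 <;> simp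
  obtain ⟨c, hc⟩ := exists_driver hL hS hL2
  obtain ⟨F, hF, hrun⟩ := finite_driver_states c
  have hK : Finite K' := Finite.of_surjective (![.main, .rev, .aux, .stack] : Fin 4 → K') (by
    rintro (_ | _ | _ | _)
    exacts [⟨0, rfl⟩, ⟨1, rfl⟩, ⟨2, rfl⟩, ⟨3, rfl⟩])
  refine ⟨_, Option K', Γ', inferInstance, inferInstance, driver (trNormal c .halt), F, hF,
    hrun, ?_⟩
  have hS1 : ∀ s : ℕ, s.unpair.2 < p s.unpair.1 → S s =
      Nat.pair s.unpair.1 (s.unpair.2 + 1) := fun s h => by simp [hSdef, h]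
  have hS2 : ∀ s : ℕ, ¬ s.unpair.2 < p s.unpair.1 → S s =
      Nat.pair (s.unpair.1 + 1) 0 := fun s h => by simp only [hSdef, h, decide_false, cond_false]
  have hcount : ∀ m, driverCount L S m = (driverArg S m).unpair.2 ∧
      (driverArg S m).unpair.2 ≤ p (driverArg S m).unpair.1 := by
    intro m
    induction m with
    | zero => simp [driverCount, driverArg]
    | succ m ih =>
      have h1 : driverArg S (m + 1) = S (driverArg S m) := Function.iterate_succ_apply' _ _ _
      rw [driverCount, h1]
      by_cases h : (driverArg S m).unpair.2 < p (driverArg S m).unpair.1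
      · have h2 : L (driverArg S m) = 0 := by simp [hLdef, h]
        have h3 : S (driverArg S m) = Nat.pair (driverArg S m).unpair.1
          ((driverArg S m).unpair.2 + 1) := hS1 _ h
        rw [h2, h3]
        simp only [if_true, Nat.unpair_pair]
        exact ⟨by rw [ih.1], h⟩
      · have h2 : L (driverArg S m) ≠ 0 := by
          simp only [hLdef, h]
          cases d (driverArg S m).unpair.1 <;> simp
        have h3 : S (driverArg S m) = Nat.pair ((driverArg S m).unpair.1 + 1) 0 := hS2 _ h
        rw [if_neg h2, h3]
        simp
  have hvisit : ∀ k i, i ≤ p k → ∃ m, driverArg S m = Nat.pair k i := by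
    have hsucc : ∀ m, driverArg S (m + 1) = S (driverArg S m) := fun m =>
      Function.iterate_succ_apply' _ _ _
    have hstep : ∀ k, (∃ m, driverArg S m = Nat.pair k 0) → ∀ i, i ≤ p k →
        ∃ m, driverArg S m = Nat.pair k i := by
      intro k h0 i
      induction i with
      | zero => exact fun _ => h0
      | succ i ih =>
        intro hi
        obtain ⟨m, hm⟩ := ih (by omega)
        exact ⟨m + 1, by rw [hsucc, hm]; simp [hSdef, show i < p k by omega]⟩
    intro k
    refine hstep k ?_
    induction k with
    | zero => exact ⟨0, rfl⟩
    | succ k ih =>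
      obtain ⟨m, hm⟩ := hstep k ih (p k) le_rfl
      exact ⟨m + 1, by rw [hsucc, hm]; simp [hSdef]⟩
  intro n b
  rw [hc]
  constructor
  · rintro ⟨m, hm, hb⟩
    obtain ⟨h1, h2⟩ := hcount m
    refine ⟨(driverArg S m).unpair.1, ?_⟩
    by_cases h : (driverArg S m).unpair.2 < p (driverArg S m).unpair.1
    · have h3 : L (driverArg S m) = 0 := by simp [hLdef, h]
      simp [h3] at hb
    · refine ⟨by omega, ?_⟩
      simp only [hLdef, h, decide_false, cond_false] at hb
      revert hb
      cases d (driverArg S m).unpair.1 <;> simp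
  · rintro ⟨k, rfl, rfl⟩
    obtain ⟨m, hm⟩ := hvisit k (p k) le_rfl
    refine ⟨m, by rw [(hcount m).1, hm, Nat.unpair_pair], ?_⟩
    simp only [hLdef, hm, Nat.unpair_pair, lt_irrefl, decide_false, cond_false]
    cases d k <;> simp

end Turing.PartrecToTM2

/-- A computable enumeration of the forbidden values of a function `ℕ → Bool` which can be avoided,
but not by a computable function. -/
theorem exists_computable_enum_diagonal : ∃ (p : ℕ → ℕ) (d : ℕ → Bool), Computable p ∧
    Computable d ∧ (∀ k, p k = 0 → d k = false) ∧ (∀ k k', p k = p k' → d k = d k') ∧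
    ∀ f : ℕ → Bool, Computable f → ∃ k, f (p k) = d k := by
  set e : ℕ → Option ℕ := fun k => Nat.Partrec.Code.evaln k.unpair.2
    (Denumerable.ofNat Nat.Partrec.Code k.unpair.1) k.unpair.1 with he
  have hu : Primrec Nat.unpair := Primrec.unpair
  have hu1 : Primrec fun s : ℕ => s.unpair.1 := Primrec.fst.comp hu
  have hu2 : Primrec fun s : ℕ => s.unpair.2 := Primrec.snd.comp hu
  have hep : Primrec e := Nat.Partrec.Code.primrec_evaln.comp
    ((hu2.pair ((Primrec.ofNat Nat.Partrec.Code).comp hu1)).pair hu1)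
  refine ⟨fun k => bif (e k).isSome then k.unpair.1 + 1 else 0, fun k => decide (e k = some 1),
    ?_, ?_, ?_, ?_, ?_⟩
  · exact (Primrec.cond (Primrec.option_isSome.comp hep) (Primrec.succ.comp hu1)
      (Primrec.const 0)).to_comp
  · exact (Primrec.eq.decide.comp hep (Primrec.const (some 1))).to_comp
  · intro k hk
    cases h : e k <;> simp_all
  · intro k k' hk
    cases h : e k with
    | none =>
      cases h' : e k' with
      | none => simp only [h, h']
      | some y => simp [h, h'] at hk
    | some y =>
      cases h' : e k' with
      | none => simp [h, h'] at hk
      | some y' =>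
        have hk : k.unpair.1 = k'.unpair.1 := by simpa [h, h'] using hk
        have h1 := Nat.Partrec.Code.evaln_sound (Option.mem_def.2 h)
        have h2 := Nat.Partrec.Code.evaln_sound (Option.mem_def.2 h')
        rw [hk] at h1
        simp only [h, h', Part.mem_unique h1 h2]
  · intro f hf
    have hg : Computable fun m => bif f (m + 1) then 1 else 0 :=
      Computable.cond (hf.comp Computable.succ) (Computable.const 1) (Computable.const 0)
    obtain ⟨c, hc⟩ := Nat.Partrec.Code.exists_code.1 (Partrec.nat_iff.1 hg.partrec)
    set n := Encodable.encode c
    have hmem : (bif f (n + 1) then 1 else 0) ∈ c.eval n := by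
      rw [hc]; exact Part.mem_some _
    obtain ⟨t, ht⟩ := Nat.Partrec.Code.evaln_complete.1 hmem
    have hek : e (Nat.pair n t) = some (bif f (n + 1) then 1 else 0) := by
      simp only [he, Nat.unpair_pair]
      rw [Denumerable.ofNat_encode]
      exact ht
    refine ⟨Nat.pair n t, ?_⟩
    simp only [hek, Option.isSome_some, cond_true, Nat.unpair_pair]
    cases f (n + 1) <;> simp

/-- There is a finite set of local rules for seeded tilings of the quadrant, such that a valid
tiling exists, but every computable sequence of bits differs at some position from the first row
of all valid tilings. -/
theorem exists_noncomputable_tiles : ∃ (T : Type) (_ : Finite T) (seed : T) (bit : T → Bool)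
    (rule : T → T → T → T → Prop),
    (∃ x : ℕ → ℕ → T, x 0 0 = seed ∧
      ∀ i j, rule (x i j) (x (i + 1) j) (x i (j + 1)) (x (i + 1) (j + 1))) ∧
    ∀ f : ℕ → Bool, Computable f → ∃ n, ∀ x : ℕ → ℕ → T, x 0 0 = seed →
      (∀ i j, rule (x i j) (x (i + 1) j) (x i (j + 1)) (x (i + 1) (j + 1))) →
      bit (x n 0) ≠ f n := by
  obtain ⟨p, d, hp, hd, h0, hcons, hdiag⟩ := exists_computable_enum_diagonal
  obtain ⟨Q, K, Γ, _, _, M, F, hF, hrun, hM⟩ :=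
    Turing.PartrecToTM2.exists_stackMachine_emits hp hd
  have hfin : Finite {t : StackMachine.Tile Q K Γ // t.state ∈ F} := by
    have := hF.to_subtype
    refine Finite.of_injective (β := F × Bool × Bool × Bool × (K → Option Γ) × (K → Option Γ))
      (fun t => (⟨t.1.state, t.2⟩, t.1.first, t.1.col, t.1.bit, t.1.tops, t.1.sym)) ?_
    rintro ⟨⟨a1, a2, a3, a4, a5, a6⟩, ha⟩ ⟨⟨b1, b2, b3, b4, b5, b6⟩, hb⟩ h
    simp only [Prod.mk.injEq, Subtype.mk.injEq] at h
    obtain ⟨rfl, rfl, rfl, rfl, rfl, rfl⟩ := h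
    rfl
  refine ⟨{t : StackMachine.Tile Q K Γ // t.state ∈ F}, hfin, ⟨M.seed, hrun 0⟩, fun t => t.1.bit,
    fun c r u w => M.Rule c.1 r.1 u.1 w.1, ?_, ?_⟩
  · classical
    set X : ℕ → Bool := fun n => decide (n = 0 ∨ ∃ k, p k = n ∧ d k = false) with hX
    refine ⟨fun i j => ⟨M.diagram X i j, hrun j⟩, ?_, fun i j => M.rule_diagram ?_ i j⟩
    · exact Subtype.ext (M.seed_eq_diagram (by simp [hX]))
    · intro n b hnb
      obtain ⟨k, rfl, rfl⟩ := (hM n b).1 hnb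
      cases hk : d k with
      | false =>
        have : X (p k) = true := by simp only [hX, decide_eq_true_eq]; exact .inr ⟨k, rfl, hk⟩
        simp [this]
      | true =>
        have : X (p k) = false := by
          simp only [hX, decide_eq_false_iff_not]
          rintro (h | ⟨k', h1, h2⟩)
          · rw [h0 k h] at hk
            exact absurd hk (by simp)
          · rw [hcons _ _ h1, hk] at h2
            exact absurd h2 (by simp)
        simp [this]
  · intro f hf
    obtain ⟨k, hk⟩ := hdiag _ hf
    refine ⟨p k, fun x hx0 hx => ?_⟩
    rw [hk]
    exact StackMachine.bit_ne_of_emits (M := M) (x := fun i j => (x i j).1)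
      (congrArg Subtype.val hx0) hx ((hM _ _).2 ⟨k, rfl, rfl⟩)

/-- If two primitive recursive relations are such that for each `n` one of them is witnessed, then
a witnessed one can be selected computably. -/
theorem exists_computable_selection {R : Bool → ℕ → ℕ → Prop} (hR : ∀ c, PrimrecRel (R c))
    (h : ∀ n, ∃ c N, R c n N) : ∃ f : ℕ → Bool, Computable f ∧ ∀ n, ∃ N, R (f n) n N := by
  classical
  have h' : ∀ n, ∃ N, R false n N ∨ R true n N := fun n => by
    obtain ⟨c, N, hN⟩ := h n
    cases c
    exacts [⟨N, Or.inl hN⟩, ⟨N, Or.inr hN⟩]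
  have hor : PrimrecPred fun p : ℕ × ℕ => R false p.1 p.2 ∨ R true p.1 p.2 :=
    (hR false).or (hR true)
  have hS : Computable₂ fun n N : ℕ => decide (R false n N ∨ R true n N) := hor.decide.to_comp
  have hfind : Computable fun n => Nat.find (h' n) := by
    refine (Partrec.rfind (hS.partrec₂)).of_eq fun n => ?_
    refine Part.eq_some_iff.2 (Nat.mem_rfind.2 ⟨?_, fun {m} hm => ?_⟩)
    · simpa using Nat.find_spec (h' n)
    · simpa using Nat.find_min (h' n) hm
  refine ⟨fun n => decide (R true n (Nat.find (h' n))),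
    (hR true).decide.to_comp.comp Computable.id hfind, fun n => ⟨Nat.find (h' n), ?_⟩⟩
  by_cases ht : R true n (Nat.find (h' n))
  · simp [ht]
  · simpa [ht] using (Nat.find_spec (h' n)).resolve_right ht

theorem PrimrecPred.exists_finite {α ι : Type*} [Primcodable α] [Finite ι] {p : ι → α → Prop}
    (hp : ∀ i, PrimrecPred (p i)) : PrimrecPred fun a => ∃ i, p i a := by
  classical
  cases nonempty_fintype ι
  have key : ∀ l : List ι, PrimrecPred fun a => ∃ i ∈ l, p i a := by
    intro l
    induction l with
    | nil => exact ⟨fun _ => inferInstanceAs (Decidable (∃ i ∈ [], p i _)),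
        by simpa using Primrec.const false⟩
    | cons i l ih => simpa using (hp i).or ih
  simpa using key Finset.univ.toList

theorem Primrec.nat_pow : Primrec₂ ((· ^ ·) : ℕ → ℕ → ℕ) :=
  Primrec₂.unpaired'.1 Nat.Primrec.pow

open Encodable in
/-- Compactness for binary constraint satisfaction problems over a finite alphabet. -/
theorem exists_solution_of_finite {κ α δ Q : Type*} [Encodable α] [Encodable δ] [Finite Q]
    {X Y : κ → δ → α} {ρ : κ → Q → Q → Prop}
    (h : ∀ N : ℕ, ∃ q : α → Q, ∀ k d, encode d < N → encode (X k d) < N → encode (Y k d) < N →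
      ρ k (q (X k d)) (q (Y k d))) :
    ∃ q : α → Q, ∀ k d, ρ k (q (X k d)) (q (Y k d)) := by
  choose s hs using h
  have key : ∀ a : α, ∃ v : Q, ∀ᶠ N in (Filter.hyperfilter ℕ : Filter ℕ), s N a = v := fun a =>
    (Ultrafilter.eventually_exists_iff (f := Filter.hyperfilter ℕ)
      (P := fun v N => s N a = v)).1 (Filter.Eventually.of_forall fun N => ⟨_, rfl⟩)
  choose q hq using key
  refine ⟨q, fun k d => ?_⟩
  have hlarge : ∀ m : ℕ, ∀ᶠ N in (Filter.hyperfilter ℕ : Filter ℕ), m < N := fun m =>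
    (Filter.eventually_gt_atTop m).filter_mono Nat.hyperfilter_le_atTop
  obtain ⟨N, h1, h2, h3, h4, h5⟩ := ((hq (X k d)).and ((hq (Y k d)).and
    ((hlarge _).and ((hlarge _).and (hlarge _))))).exists
  exact h1 ▸ h2 ▸ hs N k d h3 h4 h5

theorem exists_nat_digits {m : ℕ} (q : ℕ → ℕ) (hq : ∀ x, q x < m) (M : ℕ) :
    ∃ A < m ^ M, ∀ x < M, A / m ^ x % m = q x := by
  have hm : 0 < m := (Nat.zero_le _).trans_lt (hq 0)
  induction M generalizing q with
  | zero => exact ⟨0, by simp⟩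
  | succ M ih =>
    obtain ⟨A, hA, hd⟩ := ih (fun x => q (x + 1)) fun x => hq _
    refine ⟨q 0 + m * A, ?_, fun x hx => ?_⟩
    · rw [pow_succ']
      have := hq 0
      nlinarith
    · rcases x with _ | x
      · simp [Nat.mod_eq_of_lt (hq 0)]
      · rw [pow_succ', ← Nat.div_div_eq_div_mul, Nat.add_mul_div_left _ _ hm,
          Nat.div_eq_of_lt (hq 0), zero_add]
        exact hd x (by omega)

open Encodable in
/-- Unsatisfiability of a primitive recursively presented family of binary constraint satisfaction
problems over a finite alphabet is recursively enumerable. -/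
theorem exists_primrecRel_unsat {κ α δ Q : Type*} [Finite κ] [Primcodable α] [Primcodable δ]
    [Finite Q] [Nonempty Q] {X Y : κ → ℕ → δ → α} (hX : ∀ k, Primrec₂ (X k))
    (hY : ∀ k, Primrec₂ (Y k)) (ρ : κ → Q → Q → Prop) :
    ∃ R : ℕ → ℕ → Prop, PrimrecRel R ∧
      ∀ n, (∃ N, R n N) ↔ ¬ ∃ q : α → Q, ∀ k d, ρ k (q (X k n d)) (q (Y k n d)) := by
  classical
  obtain ⟨m, ⟨e⟩⟩ := Finite.exists_equiv_fin Q
  have hm : 0 < m := Fin.pos (e (Classical.arbitrary Q))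
  let ρ' : κ → ℕ → ℕ → Prop := fun k v w => ∃ p : {p : Q × Q // ¬ ρ k p.1 p.2},
    v = e p.1.1 ∧ w = e p.1.2
  have hρ' : ∀ k, PrimrecRel (ρ' k) := fun k => PrimrecPred.exists_finite fun p =>
    (Primrec.eq.comp Primrec.fst (Primrec.const _)).and
      (Primrec.eq.comp Primrec.snd (Primrec.const _))
  let S : κ → δ → ℕ × ℕ × ℕ → Prop := fun k d b => encode (X k b.2.1 d) < b.2.2 ∧
    encode (Y k b.2.1 d) < b.2.2 ∧ ρ' k (b.1 / m ^ encode (X k b.2.1 d) % m)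
      (b.1 / m ^ encode (Y k b.2.1 d) % m)
  have hS : ∀ k, PrimrecRel (S k) := fun k => by
    have hn : Primrec fun p : δ × ℕ × ℕ × ℕ => p.2.2.1 :=
      Primrec.fst.comp (Primrec.snd.comp Primrec.snd)
    have hM : Primrec fun p : δ × ℕ × ℕ × ℕ => p.2.2.2 :=
      Primrec.snd.comp (Primrec.snd.comp Primrec.snd)
    have hA : Primrec fun p : δ × ℕ × ℕ × ℕ => p.2.1 := Primrec.fst.comp Primrec.snd
    have hx : Primrec fun p : δ × ℕ × ℕ × ℕ => encode (X k p.2.2.1 p.1) :=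
      Primrec.encode.comp ((hX k).comp hn Primrec.fst)
    have hy : Primrec fun p : δ × ℕ × ℕ × ℕ => encode (Y k p.2.2.1 p.1) :=
      Primrec.encode.comp ((hY k).comp hn Primrec.fst)
    have hdig : ∀ {f : δ × ℕ × ℕ × ℕ → ℕ}, Primrec f → Primrec fun p => p.2.1 / m ^ f p % m :=
      fun hf => Primrec.nat_mod.comp (Primrec.nat_div.comp hA
        (Primrec.nat_pow.comp (Primrec.const m) hf)) (Primrec.const m)
    exact (Primrec.nat_lt.comp hx hM).and ((Primrec.nat_lt.comp hy hM).and
      ((hρ' k).comp (hdig hx) (hdig hy)))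
  let S' : ℕ → ℕ × ℕ × ℕ → Prop := fun j b => ∃ k, ∃ d ∈ (decode (α := δ) j).toList, S k d b
  have hS' : PrimrecRel S' := PrimrecPred.exists_finite fun k =>
    (hS k).exists_mem_list.comp (Primrec.optionToList.comp (Primrec.decode.comp Primrec.fst))
      Primrec.snd
  let R : ℕ → ℕ → Prop := fun n N => ∀ A < m ^ N, ∃ j < N, S' j (A, n, N)
  have hR : PrimrecRel R := by
    have h1 : PrimrecRel fun (A : ℕ) (b : ℕ × ℕ) => ∃ j ∈ List.range b.2, S' j (A, b) :=
      hS'.exists_mem_list.comp (Primrec.list_range.comp (Primrec.snd.comp Primrec.snd)) Primrec.id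
    have h2 : PrimrecPred fun b : ℕ × ℕ =>
        ∀ A ∈ List.range (m ^ b.2), ∃ j ∈ List.range b.2, S' j (A, b) :=
      h1.forall_mem_list.comp
        (Primrec.list_range.comp (Primrec.nat_pow.comp (Primrec.const m) Primrec.snd)) Primrec.id
    exact h2.of_eq fun b => by simp only [List.mem_range, R]
  refine ⟨R, hR, fun n => ⟨?_, fun h => ?_⟩⟩
  · rintro ⟨N, hN⟩ ⟨q, hq⟩
    obtain ⟨A, hA, hd⟩ := exists_nat_digits (m := m)
      (fun x => ((decode (α := α) x).elim ⟨0, hm⟩ fun a => e (q a) : Fin m)) (fun x => Fin.isLt _) N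
    obtain ⟨j, -, k, d, -, hx, hy, ⟨⟨v, w⟩, hvw⟩, h1, h2⟩ := hN A hA
    simp only [hd _ hx, hd _ hy, encodek, Option.elim, Fin.val_inj, e.injective.eq_iff] at h1 h2
    exact hvw (h1 ▸ h2 ▸ hq k d)
  · by_contra hN
    refine h (exists_solution_of_finite fun N => ?_)
    have : ¬ R n N := fun h => hN ⟨N, h⟩
    simp only [R, not_forall, not_exists, not_and] at this
    obtain ⟨A, -, hA⟩ := this
    refine ⟨fun a => e.symm ⟨A / m ^ encode a % m, Nat.mod_lt _ hm⟩, fun k d hd hx hy => ?_⟩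
    by_contra hρ
    exact hA _ hd ⟨k, d, by simp, hx, hy, ⟨(_, _), hρ⟩, by simp⟩

section Brouwer

open TopologicalSpace

theorem Clopens.exists_split {X : Type*} [TopologicalSpace X] [T2Space X]
    [CompactSpace X] [TotallyDisconnectedSpace X]
    (hperf : ∀ U : Set X, IsOpen U → U.Nonempty → U.Nontrivial) (U A : Clopens X) :
    ∃ B : Clopens X, A ≠ ⊥ → B ⊓ A ≠ ⊥ ∧ A \ B ≠ ⊥ ∧
      ∀ x ∈ A, ∀ y ∈ A, (x ∈ B ↔ y ∈ B) → (x ∈ U ↔ y ∈ U) := by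
  have hne : ∀ A : Clopens X, A ≠ ⊥ ↔ ∃ x, x ∈ A := fun A => by
    rw [Ne, ← SetLike.coe_set_eq, Clopens.coe_bot, ← Ne, ← Set.nonempty_iff_ne_empty]
    rfl
  simp only [hne, ← SetLike.mem_coe, Clopens.coe_inf, Clopens.coe_sdiff, Set.mem_inter_iff,
    Set.mem_sdiff]
  simp only [SetLike.mem_coe]
  by_cases h1 : ∃ x ∈ A, x ∈ U
  · by_cases h2 : ∃ x ∈ A, x ∉ U
    · exact ⟨U, fun _ => ⟨by simpa [and_comm] using h1, h2, fun _ _ _ _ => id⟩⟩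
    · push Not at h2
      by_cases hA : ∃ x, x ∈ A
      · obtain ⟨x, hx, y, hy, hxy⟩ := hperf A A.isClopen.isOpen hA
        obtain ⟨V, hV, hxV, hyV⟩ := exists_isClopen_of_totally_separated hxy
        exact ⟨⟨V, hV⟩, fun _ => ⟨⟨x, hxV, hx⟩, ⟨y, hy, hyV⟩,
          fun x hx y hy _ => iff_of_true (h2 x hx) (h2 y hy)⟩⟩
      · exact ⟨U, fun h => absurd h hA⟩
  · push Not at h1
    by_cases hA : ∃ x, x ∈ A
    · obtain ⟨x, hx, y, hy, hxy⟩ := hperf A A.isClopen.isOpen hA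
      obtain ⟨V, hV, hxV, hyV⟩ := exists_isClopen_of_totally_separated hxy
      exact ⟨⟨V, hV⟩, fun _ => ⟨⟨x, hxV, hx⟩, ⟨y, hy, hyV⟩,
        fun x hx y hy _ => iff_of_false (h1 x hx) (h1 y hy)⟩⟩
    · exact ⟨U, fun h => absurd h hA⟩

/-- Brouwer's characterization of the Cantor space. -/
theorem nonempty_homeomorph_cantor (X : Type*) [TopologicalSpace X] [T2Space X] [CompactSpace X]
    [TotallyDisconnectedSpace X] [SecondCountableTopology X] [Nonempty X]
    (hperf : ∀ U : Set X, IsOpen U → U.Nonempty → U.Nontrivial) :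
    Nonempty ((ℕ → Bool) ≃ₜ X) := by
  classical
  have : Countable (Clopens X) := Clopens.countable_iff_secondCountable.2 inferInstance
  obtain ⟨U, hU⟩ := exists_surjective_nat (Clopens X)
  choose B hB using fun (n : ℕ) (A : Clopens X) => Clopens.exists_split hperf (U n) A
  have hne : ∀ A : Clopens X, A ≠ ⊥ ↔ ∃ x, x ∈ A := fun A => by
    rw [Ne, ← SetLike.coe_set_eq, Clopens.coe_bot, ← Ne, ← Set.nonempty_iff_ne_empty]
    rfl
  let step : ℕ → Bool → Clopens X → Clopens X := fun n b A => bif b then B n A ⊓ A else A \ B n A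
  have hstep : ∀ n b A x, x ∈ step n b A ↔ x ∈ A ∧ (x ∈ B n A ↔ b = true) := by
    intro n b A x
    cases b
    · change x ∈ A \ B n A ↔ _
      rw [← SetLike.mem_coe, Clopens.coe_sdiff]
      simp
    · change x ∈ B n A ⊓ A ↔ _
      rw [← SetLike.mem_coe, Clopens.coe_inf]
      simp [and_comm]
  obtain ⟨D, hD0, hDsucc⟩ : ∃ D : (ℕ → Bool) → ℕ → Clopens X, (∀ y, D y 0 = ⊤) ∧
      ∀ y n, D y (n + 1) = step n (y n) (D y n) :=
    ⟨fun y n => Nat.rec ⊤ (fun n A => step n (y n) A) n, fun _ => rfl, fun _ _ => rfl⟩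
  have hDcongr : ∀ y y' n, (∀ i < n, y i = y' i) → D y n = D y' n := by
    intro y y' n h
    induction n with
    | zero => rw [hD0, hD0]
    | succ n ih =>
      rw [hDsucc, hDsucc, ih fun i hi => h i (by omega), h n (by omega)]
  have hDne : ∀ y n, D y n ≠ ⊥ := by
    intro y n
    induction n with
    | zero => exact (hne _).2 ⟨Classical.arbitrary X, hD0 y ▸ Set.mem_univ _⟩
    | succ n ih =>
      rw [hDsucc]
      have := hB n _ ih
      cases y n
      exacts [this.2.1, this.1]
  have hex : ∀ y, ∃ x, ∀ n, x ∈ D y n := by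
    intro y
    have := IsCompact.nonempty_iInter_of_sequence_nonempty_isCompact_isClosed
      (fun n => (D y n : Set X)) (fun n x hx => ((hstep n (y n) _ _).1 (hDsucc y n ▸ hx)).1)
      (fun n => (hne _).1 (hDne y n)) ((D y 0).isClopen.isClosed.isCompact)
      (fun n => (D y n).isClopen.isClosed)
    obtain ⟨x, hx⟩ := this
    exact ⟨x, fun n => Set.mem_iInter.1 hx n⟩
  choose g hg using hex
  have hsep : ∀ y n, ∀ x ∈ D y (n + 1), ∀ x' ∈ D y (n + 1), x ∈ U n ↔ x' ∈ U n := by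
    intro y n x hx x' hx'
    rw [hDsucc, hstep] at hx hx'
    exact (hB n _ (hDne y n)).2.2 x hx.1 x' hx'.1 (hx.2.trans hx'.2.symm)
  have hcont : Continuous g := by
    rw [continuous_def]
    intro V hV
    rw [isOpen_iff_mem_nhds]
    intro y hy
    obtain ⟨W, hW, hyW, hWV⟩ := compact_exists_isClopen_in_isOpen hV hy
    obtain ⟨n, hn⟩ := hU ⟨W, hW⟩
    filter_upwards [(PiNat.isOpen_cylinder (fun _ => Bool) y (n + 1)).mem_nhds
      (PiNat.self_mem_cylinder y (n + 1))] with y' hy'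
    refine hWV ?_
    have h1 : g y' ∈ D y (n + 1) := by
      rw [← hDcongr y' y (n + 1) hy']
      exact hg y' _
    have := (hsep y n _ (hg y _) _ h1).1
    rw [hn] at this
    exact this hyW
  have hinj : Function.Injective g := by
    intro y y' h
    have : ∀ n, ∀ i < n, y i = y' i := by
      intro n
      induction n with
      | zero => simp
      | succ n ih =>
        have h1 := hg y (n + 1)
        have h2 := hg y' (n + 1)
        rw [← h, hDsucc, hstep, ← hDcongr y y' n ih] at h2
        rw [hDsucc, hstep] at h1
        intro i hi
        rcases Nat.lt_succ_iff_lt_or_eq.1 hi with hi | rfl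
        · exact ih i hi
        · exact Bool.eq_iff_iff.2 (h1.2.symm.trans h2.2)
    exact funext fun n => this (n + 1) n (Nat.lt_succ_self n)
  have hsurj : Function.Surjective g := by
    intro x
    obtain ⟨E, hE0, hEsucc⟩ : ∃ E : ℕ → Clopens X, E 0 = ⊤ ∧
        ∀ n, E (n + 1) = step n (decide (x ∈ B n (E n))) (E n) :=
      ⟨fun n => Nat.rec ⊤ (fun n A => step n (decide (x ∈ B n A)) A) n, rfl, fun _ => rfl⟩
    let y : ℕ → Bool := fun n => decide (x ∈ B n (E n))
    have hED : ∀ n, E n = D y n := by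
      intro n
      induction n with
      | zero => rw [hE0, hD0]
      | succ n ih => rw [hEsucc, hDsucc, ← ih]
    have hx : ∀ n, x ∈ D y n := by
      intro n
      induction n with
      | zero => exact hD0 y ▸ Set.mem_univ _
      | succ n ih =>
        rw [hDsucc, hstep]
        exact ⟨ih, by rw [← hED]; simp [y]⟩
    refine ⟨y, ?_⟩
    by_contra hxy
    obtain ⟨V, hV, h1, h2⟩ := exists_isClopen_of_totally_separated hxy
    obtain ⟨n, hn⟩ := hU ⟨V, hV⟩
    have := (hsep y n _ (hg y _) _ (hx _)).1
    rw [hn] at this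
    exact h2 (this h1)
  exact ⟨hcont.homeoOfEquivCompactToT2 (f := Equiv.ofBijective g ⟨hinj, hsurj⟩)⟩

end Brouwer

theorem Cantor.nontrivial_of_isOpen (U : Set (ℕ → Bool)) (hU : IsOpen U) (hne : U.Nonempty) :
    U.Nontrivial := by
  obtain ⟨c, hc⟩ := hne
  have ht : Filter.Tendsto (fun n => Function.update c n (!c n)) Filter.atTop (𝓝 c) := by
    rw [tendsto_pi_nhds]
    intro i
    refine tendsto_const_nhds.congr' ?_
    filter_upwards [Filter.eventually_gt_atTop i] with n hn
    rw [Function.update_of_ne (by omega)]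
  obtain ⟨n, hn⟩ := (ht.eventually (hU.mem_nhds hc)).exists
  refine ⟨c, hc, _, hn, fun h => ?_⟩
  have := congrFun h n
  simp at this

theorem exists_homeomorph_prod_cantor {Z Q : Type*} [TopologicalSpace Z] [T2Space Z]
    [CompactSpace Z] [TotallyDisconnectedSpace Z] [SecondCountableTopology Z]
    (hZ : ∀ U : Set Z, IsOpen U → U.Nonempty → U.Nontrivial)
    [Finite Q] [TopologicalSpace Q] [DiscreteTopology Q] {k : Z → Q} (hk : Continuous k)
    (hks : Function.Surjective k) : ∃ θ : (Q × (ℕ → Bool)) ≃ₜ Z, ∀ p, k (θ p) = p.1 := by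
  have hfib : ∀ i, Nonempty ((ℕ → Bool) ≃ₜ {z // k z = i}) := fun i => by
    have hcl : IsClopen {z | k z = i} := (isClopen_discrete {i}).preimage hk
    have : CompactSpace {z // k z = i} := isCompact_iff_compactSpace.1 hcl.isClosed.isCompact
    have : SecondCountableTopology {z // k z = i} := inferInstanceAs
      (SecondCountableTopology {z | k z = i})
    have : Nonempty {z // k z = i} := let ⟨z, hz⟩ := hks i; ⟨⟨z, hz⟩⟩
    refine nonempty_homeomorph_cantor _ fun U hU hne => ?_
    obtain ⟨a, ⟨x, hx, rfl⟩, b, ⟨y, hy, rfl⟩, hab⟩ := hZ (Subtype.val '' U)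
      (hcl.isOpen.isOpenMap_subtype_val U hU) (hne.image _)
    exact ⟨x, hx, y, hy, fun h => hab (h ▸ rfl)⟩
  let e := fun i => (hfib i).some
  let θ : (Q × (ℕ → Bool)) ≃ Z :=
    { toFun := fun p => e p.1 p.2
      invFun := fun z => (k z, (e (k z)).symm ⟨z, rfl⟩)
      left_inv := by
        rintro ⟨i, c⟩
        have : ∀ (j : Q) (z : {z // k z = i}) (h : k z.1 = j),
            (j, (e j).symm ⟨z.1, h⟩) = (i, (e i).symm z) := by
          rintro j ⟨z, rfl⟩ rfl
          rfl
        simpa using this (k (e i c).1) (e i c) rfl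
      right_inv := fun z => by simp }
  have hθ : Continuous θ := continuous_prod_of_discrete_left.2 fun i =>
    continuous_subtype_val.comp (e i).continuous
  exact ⟨hθ.homeoOfEquivCompactToT2, fun p => (e p.1 p.2).2⟩

/-- Two Cantor spaces coloured by a finite set, all colours being used, are homeomorphic by a
colour-preserving map. -/
theorem exists_homeomorph_comp_eq {X Y Q : Type*} [TopologicalSpace X] [T2Space X]
    [CompactSpace X] [TotallyDisconnectedSpace X] [SecondCountableTopology X]
    (hX : ∀ U : Set X, IsOpen U → U.Nonempty → U.Nontrivial)
    [TopologicalSpace Y] [T2Space Y]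
    [CompactSpace Y] [TotallyDisconnectedSpace Y] [SecondCountableTopology Y]
    (hY : ∀ U : Set Y, IsOpen U → U.Nonempty → U.Nontrivial)
    [Finite Q] [TopologicalSpace Q] [DiscreteTopology Q] {f : X → Q} {g : Y → Q}
    (hf : Continuous f) (hg : Continuous g) (hfs : Function.Surjective f)
    (hgs : Function.Surjective g) : ∃ θ : X ≃ₜ Y, ∀ x, g (θ x) = f x := by
  obtain ⟨θ, hθ⟩ := exists_homeomorph_prod_cantor hX hf hfs
  obtain ⟨η, hη⟩ := exists_homeomorph_prod_cantor hY hg hgs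
  exact ⟨θ.symm.trans η, fun x => by
    rw [Homeomorph.trans_apply, hη, ← hθ (θ.symm x), θ.apply_symm_apply]⟩

/-- Configurations from a closed right-invariant set are realized as itineraries of an action on
the Cantor space. -/
theorem exists_action_of_configurations {G : Type} [Group G] [Countable G] {Q : Type*} [Finite Q]
    [TopologicalSpace Q] [DiscreteTopology Q] {κ : Cantor → Q} (hκ : Continuous κ)
    (hs : Function.Surjective κ) {Z : Set (G → Q)} (hZ : IsClosed Z)
    (hinv : ∀ z ∈ Z, ∀ g : G, (fun h => z (h * g)) ∈ Z) (hocc : ∀ i, ∃ z ∈ Z, z 1 = i) :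
    ∃ β : ActSpace G, ∀ p, ∃ z ∈ Z, ∀ g, κ (β.1 g p) = z g := by
  have : CompactSpace Z := isCompact_iff_compactSpace.1 hZ.isCompact
  have hperf : ∀ U : Set (Z × Cantor), IsOpen U → U.Nonempty → U.Nontrivial := by
    rintro U hU ⟨⟨z, c⟩, hzc⟩
    obtain ⟨x, hx, y, hy, hxy⟩ := Cantor.nontrivial_of_isOpen {c | (z, c) ∈ U}
      (hU.preimage (Continuous.prodMk_right z)) ⟨c, hzc⟩
    exact ⟨_, hx, _, hy, fun h => hxy (congrArg Prod.snd h)⟩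
  obtain ⟨θ, hθ⟩ := exists_homeomorph_comp_eq (f := fun p : Z × Cantor => p.1.1 1) (g := κ)
    hperf Cantor.nontrivial_of_isOpen
    ((continuous_apply 1).comp (continuous_subtype_val.comp continuous_fst)) hκ
    (fun i => let ⟨z, hz, h⟩ := hocc i; ⟨(⟨z, hz⟩, fun _ => true), h⟩) hs
  let m : G → Z × Cantor → Z × Cantor := fun g p => (⟨_, hinv p.1.1 p.1.2 g⟩, p.2)
  have hm : ∀ g, Continuous (m g) := fun g => by
    refine Continuous.prodMk (Continuous.subtype_mk ?_ _) continuous_snd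
    exact continuous_pi fun h => (continuous_apply (h * g)).comp
      (continuous_subtype_val.comp continuous_fst)
  refine ⟨⟨fun g => ⟨θ ∘ m g ∘ θ.symm, by have := hm g; fun_prop⟩, ?_, fun g h => ?_⟩,
    fun p => ⟨(θ.symm p).1.1, (θ.symm p).1.2, fun g => ?_⟩⟩
  · ext1 p
    have : m 1 (θ.symm p) = θ.symm p := by
      refine Prod.ext (Subtype.ext (funext fun k => ?_)) rfl
      simp [m]
    simp [this]
  · ext1 p
    have : m (g * h) (θ.symm p) = m g (m h (θ.symm p)) := by
      refine Prod.ext (Subtype.ext (funext fun k => ?_)) rfl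
      simp [m, mul_assoc]
    simp [this]
  · change κ (θ _) = _
    rw [hθ]
    simp [m]

theorem ActSpace.isClosed_isAction (G : Type) [Group G] :
    IsClosed {α : G → C(Cantor, Cantor) | IsAction G α} := by
  have hc : ∀ g, Continuous fun α : G → C(Cantor, Cantor) => α g := continuous_apply
  simp only [IsAction, Set.ofPred_and, Set.ofPred_forall]
  refine (isClosed_eq (hc 1) continuous_const).inter
    (isClosed_iInter fun g => isClosed_iInter fun h => isClosed_eq (hc _) ?_)
  exact ContinuousMap.continuous_comp'.comp ((hc h).prodMk (hc g))

theorem ContinuousMap.isCompletelyMetrizableSpace (X Y : Type*) [TopologicalSpace X]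
    [CompactSpace X] [TopologicalSpace Y] [TopologicalSpace.IsCompletelyMetrizableSpace Y] :
    TopologicalSpace.IsCompletelyMetrizableSpace C(X, Y) := by
  let _ := TopologicalSpace.upgradeIsCompletelyMetrizable Y
  exact (inferInstance : TopologicalSpace.IsCompletelyMetrizableSpace C(X, Y))

theorem ActSpace.baireSpace (G : Type) [Group G] [Countable G] : BaireSpace (ActSpace G) := by
  have : TopologicalSpace.IsCompletelyMetrizableSpace C(Cantor, Cantor) :=
    ContinuousMap.isCompletelyMetrizableSpace _ _
  have : TopologicalSpace.IsCompletelyMetrizableSpace (ActSpace G) :=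
    (ActSpace.isClosed_isAction G).isCompletelyMetrizableSpace
  let _ := TopologicalSpace.upgradeIsCompletelyMetrizable (ActSpace G)
  exact (inferInstance : BaireSpace (ActSpace G))

theorem ActSpace.continuous_eval {G : Type} [Group G] (g : G) :
    Continuous fun x : ActSpace G × Cantor => x.1.1 g x.2 := by
  have h1 : Continuous fun x : ActSpace G × Cantor => x.1.1 g :=
    (continuous_apply g).comp (continuous_subtype_val.comp continuous_fst)
  exact h1.eval continuous_snd

theorem isClopen_setOf_exists {X Y L : Type*} [TopologicalSpace X] [TopologicalSpace Y]
    [CompactSpace Y] [TopologicalSpace L] [DiscreteTopology L] {f : X × Y → L}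
    (hf : Continuous f) (S : Set L) : IsClopen {x | ∃ y, f (x, y) ∈ S} := by
  have hS : IsClopen (f ⁻¹' S) := (isClopen_discrete S).preimage hf
  have : {x | ∃ y, f (x, y) ∈ S} = Prod.fst '' (f ⁻¹' S) := by
    ext x
    simp
  rw [this]
  exact ⟨isClosedMap_fst_of_compactSpace _ hS.isClosed, isOpenMap_fst _ hS.isOpen⟩

theorem countable_continuousMap_cantor (L : Type*) [Finite L] [TopologicalSpace L]
    [DiscreteTopology L] : Countable C(Cantor, L) := by
  have : Countable (TopologicalSpace.Clopens Cantor) :=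
    TopologicalSpace.Clopens.countable_iff_secondCountable.2 inferInstance
  refine Function.Injective.countable
    (f := fun (k : C(Cantor, L)) (l : L) =>
      (⟨k ⁻¹' {l}, (isClopen_discrete {l}).preimage k.continuous⟩ :
        TopologicalSpace.Clopens Cantor)) fun k k' h => ?_
  ext1 p
  have : p ∈ k' ⁻¹' {k p} := by
    have h1 := congrArg (fun V : TopologicalSpace.Clopens Cantor => (V : Set Cantor))
      (congrFun h (k p))
    have h2 : k ⁻¹' {k p} = k' ⁻¹' {k p} := h1
    exact h2 ▸ rfl
  exact this.symm

/-- On a comeager set, let a family of clopen events be determined by an invariant with countably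
many values. Then the events are simultaneously constant on some nonempty open set. -/
theorem exists_open_constant_events {X I K : Type*} [TopologicalSpace X] [BaireSpace X]
    [Countable I] {C U : Set X} (hC : C ∈ residual X) (hU : IsOpen U) (hne : U.Nonempty)
    {D : K → Set X} (hD : ∀ k, IsClopen (D k)) {t : I → K → Prop}
    (ht : ∀ x ∈ C, ∃ i, ∀ k, x ∈ D k ↔ t i k) :
    ∃ V ⊆ U, IsOpen V ∧ V.Nonempty ∧ ∀ x ∈ V, ∀ y ∈ V, ∀ k, x ∈ D k ↔ y ∈ D k := by
  obtain ⟨s, hsC, hs, hd⟩ := mem_residual.1 hC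
  have hcl : ∀ i, IsClosed {x | ∀ k, x ∈ D k ↔ t i k} := fun i => by
    rw [Set.ofPred_forall]
    refine isClosed_iInter fun k => ?_
    by_cases h : t i k
    · simpa [h] using (hD k).isClosed
    · simp only [h, iff_false]
      exact (hD k).compl.isClosed
  obtain ⟨x, hxU, hx⟩ := (hs.dense_iUnion_interior_of_closed hd hcl fun x hx =>
    Set.mem_iUnion.2 (ht x (hsC hx))).inter_open_nonempty U hU hne
  obtain ⟨i, hi⟩ := Set.mem_iUnion.1 hx
  exact ⟨_, Set.inter_subset_left, hU.inter isOpen_interior, ⟨x, hxU, hi⟩, fun x hx y hy k =>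
    (interior_subset hx.2 k).trans (interior_subset hy.2 k).symm⟩

theorem exists_cylinder_subset {K U : Set Cantor} (hK : IsCompact K) (hU : IsOpen U)
    (h : K ⊆ U) : ∃ N : ℕ, ∀ y ∈ K, ∀ y' : Cantor, (∀ i < N, y' i = y i) → y' ∈ U := by
  let O : ℕ → Set Cantor := fun N => {y | PiNat.cylinder y N ⊆ U}
  have hO : ∀ N, IsOpen (O N) := fun N => isOpen_iff_mem_nhds.2 fun y hy => by
    filter_upwards [(PiNat.isOpen_cylinder (fun _ => Bool) y N).mem_nhds
      (PiNat.self_mem_cylinder y N)] with y' hy'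
    change PiNat.cylinder y' N ⊆ U
    rwa [PiNat.mem_cylinder_iff_eq.1 hy']
  obtain ⟨N, hN⟩ := hK.elim_directed_cover O hO (fun y hy => by
    obtain ⟨V, ⟨x, n, rfl⟩, hyV, hVU⟩ :=
      (PiNat.isTopologicalBasis_cylinders (fun _ => Bool)).exists_subset_of_mem_open (h hy) hU
    refine Set.mem_iUnion.2 ⟨n, ?_⟩
    change PiNat.cylinder y n ⊆ U
    rwa [PiNat.mem_cylinder_iff_eq.1 hyV])
    (directed_of_isDirected_le fun m n hmn y hy => (PiNat.cylinder_anti y hmn).trans hy)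
  exact ⟨N, fun y hy y' hy' => hN hy hy'⟩

/-- An open set of actions contains with `α` every action all of whose one-step transitions
between cells of some finite partition are transitions of `α`. -/
theorem ActSpace.exists_transitions_subset {G : Type} [Group G] {V : Set (ActSpace G)}
    (hV : IsOpen V) {α : ActSpace G} (hα : α ∈ V) : ∃ (N₀ : ℕ) (E : Finset G), ∀ N ≥ N₀,
      ∀ β : ActSpace G, (∀ g ∈ E, ∀ p, ∃ p', (∀ i < N, p i = p' i) ∧
        ∀ i < N, β.1 g p i = α.1 g p' i) → β ∈ V := by
  classical
  by_contra hcon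
  push Not at hcon
  choose N hN β hβ hβV using hcon
  have ht : Filter.Tendsto (fun x : ℕ × Finset G => β x.1 x.2) Filter.atTop (𝓝 α) := by
    rw [tendsto_subtype_rng, tendsto_pi_nhds]
    intro g
    rw [ContinuousMap.tendsto_nhds_compactOpen]
    intro K hK U hU hKU
    obtain ⟨N₁, h₁⟩ := exists_cylinder_subset hK (hU.preimage (α.1 g).continuous) hKU
    have hK' : IsCompact {p' : Cantor | ∃ p ∈ K, ∀ i < N₁, p' i = p i} := by
      have hr : Continuous fun (p : Cantor) (i : Fin N₁) => p i := by fun_prop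
      have := ((isClopen_discrete ((fun (p : Cantor) (i : Fin N₁) => p i) '' K)).preimage
        hr).isClosed.isCompact
      convert this using 1
      ext p'
      simp [funext_iff, Fin.forall_iff, eq_comm]
    obtain ⟨N₂, h₂⟩ := exists_cylinder_subset (hK'.image (α.1 g).continuous) hU (by
      rintro _ ⟨p', ⟨p, hp, hpp'⟩, rfl⟩
      exact h₁ p hp p' hpp')
    filter_upwards [Filter.eventually_ge_atTop (max N₁ N₂, {g})] with x hx p hp
    have hN' : max N₁ N₂ ≤ N x.1 x.2 := hx.1.trans (hN _ _)
    obtain ⟨p', hpp', hq⟩ := hβ x.1 x.2 g (hx.2 (by simp)) p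
    refine h₂ _ ⟨p', ⟨p, hp, fun i hi => (hpp' i (by omega)).symm⟩, rfl⟩ _
      fun i hi => hq i (by omega)
  obtain ⟨x, hx⟩ := (ht.eventually (hV.mem_nhds hα)).exists
  exact hβV _ _ hx

/-- A function on words that does not see the insertion of trivial words `x x⁻¹` and of relators
depends only on the group element represented by the word. -/
theorem FreeGroup.eq_of_relator_invariant {ι G Q : Type*} [DecidableEq ι] [Group G]
    (φ : FreeGroup ι →* G) {S : Set (FreeGroup ι)} (hS : Subgroup.normalClosure S = φ.ker)
    {q : List (ι × Bool) → Q}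
    (hfree : ∀ x b u v, q (u ++ v) = q (u ++ ([(x, b), (x, !b)] ++ v)))
    (hrel : ∀ r ∈ S, ∀ u v, q (u ++ v) = q (u ++ (r.toWord ++ v))) {w w' : List (ι × Bool)}
    (h : φ (FreeGroup.mk w) = φ (FreeGroup.mk w')) : q w = q w' := by
  obtain ⟨f, hf⟩ : ∃ f : FreeGroup ι → Q, ∀ w, f (FreeGroup.mk w) = q w :=
    ⟨Quot.lift q fun _ _ h => by
      cases h with
      | not => simpa using (hfree _ _ _ _).symm, fun _ => rfl⟩
  let N : Subgroup (FreeGroup ι) :=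
    { carrier := {g | ∀ u v, f (u * g * v) = f (u * v)}
      one_mem' := fun u v => by simp
      mul_mem' := fun {a b} ha hb u v => by
        rw [← mul_assoc, hb, ha]
      inv_mem' := fun {a} ha u v => by
        rw [← ha (u * a⁻¹) v]
        simp }
  have hN : N.Normal := ⟨fun g hg c u v => by
    have := hg (u * c) (c⁻¹ * v)
    simpa [mul_assoc] using this⟩
  have hle : φ.ker ≤ N := hS ▸ Subgroup.normalClosure_le_normal fun r hr u v => by
    rw [← FreeGroup.mk_toWord (x := u), ← FreeGroup.mk_toWord (x := v),
      ← FreeGroup.mk_toWord (x := r), FreeGroup.mul_mk, FreeGroup.mul_mk, FreeGroup.mul_mk,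
      hf, hf, List.append_assoc]
    exact (hrel r hr _ _).symm
  have hmem : (FreeGroup.mk w)⁻¹ * FreeGroup.mk w' ∈ N := hle (by
    rw [MonoidHom.mem_ker, _root_.map_mul, _root_.map_inv, h, inv_mul_cancel])
  have := hmem (FreeGroup.mk w) 1
  rw [mul_one, mul_inv_cancel_left, mul_one, hf, hf] at this
  exact this.symm

theorem Primrec.append_replicate {α β : Type*} [Primcodable α] [Primcodable β] {f : β → ℕ}
    {g : β → List α} (hf : Primrec f) (hg : Primrec g) (a : α) :
    Primrec fun b => List.replicate (f b) a ++ g b := by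
  refine (Primrec.nat_rec' hf hg (h := fun _ p => a :: p.2)
    (Primrec.list_cons.comp (Primrec.const a) (Primrec.snd.comp Primrec.snd)).to₂).of_eq fun b => ?_
  induction f b with
  | zero => rfl
  | succ n ih => simp [List.replicate_succ, ih]

/-- For a finitely presented group, it is recursively enumerable whether an event depending on the
`n`-th power of a generator is forced by constraints on the one-step transitions of an action with
respect to a clopen partition. -/
theorem exists_primrecRel_forced {G : Type} [Group G] [Countable G] {k : ℕ} {s : Fin k → G}
    (hs : Function.Surjective (FreeGroup.lift s))
    (hfin : (FreeGroup.lift s).ker.IsFinitelyNormallyGenerated) (a : Fin k)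
    {Q : Type} [Finite Q] [Primcodable Q] [TopologicalSpace Q] [DiscreteTopology Q] {κ : Cantor → Q}
    (hκ : Continuous κ) (hκs : Function.Surjective κ) (T : Fin k → Q → Q → Prop)
    (B : Q → Q → Prop) :
    ∃ R : ℕ → ℕ → Prop, PrimrecRel R ∧ ∀ n, (∃ N, R n N) ↔
      ∀ β : ActSpace G, (∀ l p, T l (κ p) (κ (β.1 (s l) p))) →
        ∃ p, B (κ p) (κ (β.1 (s a ^ n) p)) := by
  obtain ⟨S, hSfin, hS⟩ := hfin
  have : Finite S := hSfin
  have : Nonempty Q := ⟨κ fun _ => true⟩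
  let rel : (Fin k × Bool) ⊕ S → List (Fin k × Bool) :=
    Sum.elim (fun x => [(x.1, x.2), (x.1, !x.2)]) fun r => r.1.toWord
  let X : ((Fin k × Bool) ⊕ S) ⊕ Fin k ⊕ Q ⊕ Unit → ℕ →
      Q × List (Fin k × Bool) × List (Fin k × Bool) → Q × List (Fin k × Bool) := fun c _ d =>
    c.elim (fun _ => (d.1, d.2.1 ++ d.2.2)) <| Sum.elim (fun _ => (d.1, d.2.2)) <|
      Sum.elim (fun i => (i, [])) fun _ => (d.1, d.2.2)
  let Y : ((Fin k × Bool) ⊕ S) ⊕ Fin k ⊕ Q ⊕ Unit → ℕ →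
      Q × List (Fin k × Bool) × List (Fin k × Bool) → Q × List (Fin k × Bool) := fun c n d =>
    c.elim (fun r => (d.1, d.2.1 ++ (rel r ++ d.2.2))) <|
      Sum.elim (fun l => (d.1, (l, true) :: d.2.2)) <|
      Sum.elim (fun i => (i, [])) fun _ => (d.1, List.replicate n (a, true) ++ d.2.2)
  let ρ : ((Fin k × Bool) ⊕ S) ⊕ Fin k ⊕ Q ⊕ Unit → Q → Q → Prop := fun c x y =>
    c.elim (fun _ => x = y) <| Sum.elim (fun l => T l x y) <|
      Sum.elim (fun i => x = i) fun _ => ¬ B x y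
  have hd1 : Primrec fun p : ℕ × Q × List (Fin k × Bool) × List (Fin k × Bool) => p.2.1 :=
    Primrec.fst.comp Primrec.snd
  have hdu : Primrec fun p : ℕ × Q × List (Fin k × Bool) × List (Fin k × Bool) => p.2.2.1 :=
    Primrec.fst.comp (Primrec.snd.comp Primrec.snd)
  have hdv : Primrec fun p : ℕ × Q × List (Fin k × Bool) × List (Fin k × Bool) => p.2.2.2 :=
    Primrec.snd.comp (Primrec.snd.comp Primrec.snd)
  have hX : ∀ c, Primrec₂ (X c) := by
    rintro (_ | _ | i | _)
    · exact hd1.pair (Primrec.list_append.comp hdu hdv)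
    · exact hd1.pair hdv
    · exact Primrec.const _
    · exact hd1.pair hdv
  have hY : ∀ c, Primrec₂ (Y c) := by
    rintro (r | l | i | _)
    · exact hd1.pair (Primrec.list_append.comp hdu
        (Primrec.list_append.comp (Primrec.const (rel r)) hdv))
    · exact hd1.pair (Primrec.list_cons.comp (Primrec.const (l, true)) hdv)
    · exact Primrec.const _
    · exact hd1.pair (Primrec.append_replicate Primrec.fst hdv _)
  obtain ⟨R, hR, hRn⟩ := exists_primrecRel_unsat hX hY ρ
  refine ⟨R, hR, fun n => (hRn n).trans ?_⟩
  rw [← not_iff_not, not_not]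
  push Not
  let ev : List (Fin k × Bool) → G := fun w => FreeGroup.lift s (FreeGroup.mk w)
  have hev_append : ∀ u v, ev (u ++ v) = ev u * ev v := fun u v => by
    simp only [ev, ← FreeGroup.mul_mk, map_mul]
  have hev_nil : ev [] = 1 := map_one _
  have hev_cons : ∀ l v, ev ((l, true) :: v) = s l * ev v := fun l v => by
    rw [← List.singleton_append, hev_append]
    simp [ev]
  have hev_rep : ∀ v, ev (List.replicate n (a, true) ++ v) = s a ^ n * ev v := fun v => by
    induction n with
    | zero => simp
    | succ n ih => rw [List.replicate_succ, List.cons_append, hev_cons, ih, pow_succ', mul_assoc]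
  have hev_rel : ∀ r, ev (rel r) = 1 := by
    rintro (⟨x, b⟩ | r)
    · simp only [rel, Sum.elim_inl, ev, FreeGroup.lift_mk]
      cases b <;> simp
    · have : (r : FreeGroup (Fin k)) ∈ (FreeGroup.lift s).ker :=
        hS ▸ Subgroup.subset_normalClosure r.2
      simpa only [rel, Sum.elim_inr, ev, FreeGroup.mk_toWord] using MonoidHom.mem_ker.1 this
  constructor
  · rintro ⟨q, hq⟩
    have hqev : ∀ i w w', ev w = ev w' → q (i, w) = q (i, w') := fun i w w' h =>
      FreeGroup.eq_of_relator_invariant (q := fun w => q (i, w)) (FreeGroup.lift s) hS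
        (fun x b u v => hq (.inl (.inl (x, b))) (i, u, v))
        (fun r hr u v => hq (.inl (.inr ⟨r, hr⟩)) (i, u, v)) h
    have hsurj : ∀ g, ∃ w, ev w = g := fun g => by
      obtain ⟨x, rfl⟩ := hs g
      exact ⟨x.toWord, by simp only [ev, FreeGroup.mk_toWord]⟩
    choose word hword using hsurj
    let Z : Set (G → Q) := {z | (∀ l h, T l (z h) (z (s l * h))) ∧ ∀ h, ¬ B (z h) (z (s a ^ n * h))}
    have hclosed : ∀ (P : Q → Q → Prop) (g h : G), IsClosed {z : G → Q | P (z g) (z h)} :=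
      fun P g h => (isClosed_discrete {x : Q × Q | P x.1 x.2}).preimage
        (f := fun z : G → Q => (z g, z h)) (by fun_prop)
    have hZ : IsClosed Z := by
      have : Z = (⋂ l, ⋂ h, {z | T l (z h) (z (s l * h))}) ∩
          ⋂ h, {z | ¬ B (z h) (z (s a ^ n * h))} := by
        ext z
        simp [Z]
      rw [this]
      exact (isClosed_iInter fun l => isClosed_iInter fun h => hclosed (T l) _ _).inter
        (isClosed_iInter fun h => hclosed (fun x y => ¬ B x y) _ _)
    obtain ⟨β, hβ⟩ := exists_action_of_configurations hκ hκs hZ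
      (fun z hz g => ⟨fun l h => by simpa only [mul_assoc] using hz.1 l (h * g),
        fun h => by simpa only [mul_assoc] using hz.2 (h * g)⟩)
      (fun i => ⟨fun g => q (i, word g), ⟨fun l h => by
        have := hq (.inr (.inl l)) (i, [], word h)
        change T l (q (i, word h)) (q (i, word (s l * h)))
        rwa [show q (i, word (s l * h)) = q (i, (l, true) :: word h) from hqev _ _ _ (by
          rw [hev_cons, hword, hword])], fun h => by
        have := hq (.inr (.inr (.inr ()))) (i, [], word h)
        change ¬ B (q (i, word h)) (q (i, word (s a ^ n * h)))
        rwa [show q (i, word (s a ^ n * h)) = q (i, List.replicate n (a, true) ++ word h) from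
          hqev _ _ _ (by rw [hev_rep, hword, hword])]⟩,
        (hqev i _ [] (by rw [hword, hev_nil])).trans (hq (.inr (.inr (.inl i))) (i, [], []))⟩)
    refine ⟨β, fun l p => ?_, fun p => ?_⟩
    · obtain ⟨z, hz, h⟩ := hβ p
      have := hz.1 l 1
      rw [mul_one, ← h, ← h, β.2.1] at this
      exact this
    · obtain ⟨z, hz, h⟩ := hβ p
      have := hz.2 1
      rw [mul_one, ← h, ← h, β.2.1] at this
      exact this
  · rintro ⟨β, hT, hB⟩
    choose p hp using hκs
    refine ⟨fun x => κ (β.1 (ev x.2) (p x.1)), ?_⟩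
    rintro (r | l | i | _) ⟨j, u, v⟩
    · change κ (β.1 (ev (u ++ v)) (p j)) = κ (β.1 (ev (u ++ (rel r ++ v))) (p j))
      rw [hev_append, hev_append, hev_append, hev_rel, one_mul]
    · change T l (κ (β.1 (ev v) (p j))) (κ (β.1 (ev ((l, true) :: v)) (p j)))
      rw [hev_cons, β.2.2]
      exact hT l _
    · change κ (β.1 (ev []) (p i)) = i
      rw [hev_nil, β.2.1]
      exact hp i
    · change ¬ B (κ (β.1 (ev v) (p j))) (κ (β.1 (ev (List.replicate n (a, true) ++ v)) (p j)))
      rw [hev_rep, β.2.2]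
      exact hB _

/-- The first `m` digits of a point of the Cantor space. -/
def Cantor.truncate (m : ℕ) (p : Cantor) : Fin m → Bool := fun i => p i

theorem Cantor.continuous_truncate (m : ℕ) : Continuous (Cantor.truncate m) :=
  continuous_pi fun _ => continuous_apply _

theorem Cantor.surjective_truncate (m : ℕ) : Function.Surjective (Cantor.truncate m) := fun w =>
  ⟨fun i => if h : i < m then w ⟨i, h⟩ else true, funext fun i => by simp [Cantor.truncate]⟩

theorem exists_surjective_digits (L : Type*) [Finite L] [Nonempty L] :
    ∃ (m : ℕ) (π : (Fin m → Bool) → L), Function.Surjective π := by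
  obtain ⟨m, ⟨e⟩⟩ := Finite.exists_equiv_fin L
  refine ⟨m, _, Function.invFun_surjective (f := fun l i => decide (e l = i)) fun l l' h => ?_⟩
  have := congrFun h (e l)
  simpa [eq_comm] using this

theorem Group.FG.exists_surjective_lift {G : Type*} [Group G] (hG : Group.FG G) (E : Finset G) :
    ∃ (k : ℕ) (s : Fin k → G), Function.Surjective (FreeGroup.lift s) ∧
      ∀ g ∈ E, ∃ l, s l = g := by
  classical
  obtain ⟨S, hS⟩ := hG.out
  let e := (S ∪ E).equivFin
  have hr : Set.range (fun l => (e.symm l : G)) = ↑(S ∪ E) := by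
    rw [Set.range_comp' Subtype.val e.symm, e.symm.surjective.range_eq, Set.image_univ,
      Subtype.range_coe]
  refine ⟨_, fun l => e.symm l, ?_, fun g hg => ?_⟩
  · rw [← MonoidHom.range_eq_top, FreeGroup.range_lift_eq_closure, hr, eq_top_iff, ← hS]
    exact Subgroup.closure_mono (by simp)
  · have : g ∈ Set.range (fun l => (e.symm l : G)) := hr ▸ by simp [hg]
    exact this

/-- If two families of events are constant on a neighbourhood of an action of a finitely generated
nilpotent group, and one of the two events always holds, then a true event can be selected
computably. -/
theorem exists_computable_of_constant_events {G : Type} [Group G] [Countable G]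
    [Group.IsNilpotent G] (hG : Group.FG G) (a : G) {m : ℕ}
    (S : Bool → Set ((Fin m → Bool) × (Fin m → Bool))) {V : Set (ActSpace G)} (hV : IsOpen V)
    {α : ActSpace G} (hα : α ∈ V)
    (hconst : ∀ β ∈ V, ∀ n c,
      (∃ p, (Cantor.truncate m p, Cantor.truncate m (α.1 (a ^ n) p)) ∈ S c) →
        ∃ p, (Cantor.truncate m p, Cantor.truncate m (β.1 (a ^ n) p)) ∈ S c)
    (hex : ∀ n, ∃ c, ∃ p, (Cantor.truncate m p, Cantor.truncate m (α.1 (a ^ n) p)) ∈ S c) :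
    ∃ f : ℕ → Bool, Computable f ∧
      ∀ n, ∃ p, (Cantor.truncate m p, Cantor.truncate m (α.1 (a ^ n) p)) ∈ S (f n) := by
  classical
  obtain ⟨N₀, E, hE⟩ := ActSpace.exists_transitions_subset hV hα
  obtain ⟨k, s, hs, hsE⟩ := hG.exists_surjective_lift (insert a E)
  obtain ⟨l₀, rfl⟩ := hsE a (Finset.mem_insert_self _ _)
  let N := max N₀ m
  let τ : (Fin N → Bool) → Fin m → Bool := fun w i => w (Fin.castLE (le_max_right _ _) i)
  let T : Fin k → (Fin N → Bool) → (Fin N → Bool) → Prop := fun l x y =>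
    ∃ p, Cantor.truncate N p = x ∧ Cantor.truncate N (α.1 (s l) p) = y
  choose R hR hRn using fun c => exists_primrecRel_forced hs
    (Group.IsNilpotent.ker_isFinitelyNormallyGenerated G _ hs) l₀ (Cantor.continuous_truncate N)
    (Cantor.surjective_truncate N) T fun x y => (τ x, τ y) ∈ S c
  obtain ⟨f, hf, hfR⟩ := exists_computable_selection hR fun n => by
    obtain ⟨c, hc⟩ := hex n
    refine ⟨c, (hRn c n).2 fun β hβ => hconst β (hE N (le_max_left _ _) β fun g hg p => ?_) n c hc⟩
    obtain ⟨l, rfl⟩ := hsE g (Finset.mem_insert_of_mem hg)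
    obtain ⟨p', h, h'⟩ := hβ l p
    exact ⟨p', fun i hi => (congrFun h ⟨i, hi⟩).symm, fun i hi => (congrFun h' ⟨i, hi⟩).symm⟩
  exact ⟨f, hf, fun n => (hRn _ n).1 (hfR n) α fun l p => ⟨p, rfl, rfl⟩⟩

/-- The local rule of a tiling of a quadrant, extended to partial colorings whose domain is closed
under the two unit translations. -/
def PartialRule {T : Type*} (rule : T → T → T → T → Prop)
    (l : Option T × Option T × Option T × Option T) : Prop :=
  ∀ c, l.1 = some c → ∃ r u v, l.2.1 = some r ∧ l.2.2.1 = some u ∧ l.2.2.2 = some v ∧ rule c r u v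

theorem PartialRule.exists_tiling {G : Type*} [Group G] {a b : G} (hab : a * b = b * a) {T : Type*}
    {rule : T → T → T → T → Prop} {z : G → Option T}
    (hz : ∀ h, PartialRule rule (z h, z (a * h), z (b * h), z (a * b * h))) {t : T}
    (ht : z 1 = some t) : ∃ y : ℕ → ℕ → T, y 0 0 = t ∧
      (∀ i j, rule (y i j) (y (i + 1) j) (y i (j + 1)) (y (i + 1) (j + 1))) ∧
      ∀ i j, z (a ^ i * b ^ j) = some (y i j) := by
  have hb : ∀ j, (z (b ^ j)).isSome := fun j => by
    induction j with
    | zero => simp [ht]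
    | succ j ih =>
      obtain ⟨c, hc⟩ := Option.isSome_iff_exists.1 ih
      obtain ⟨r, u, v, -, h, -⟩ := hz _ c hc
      simp only [← pow_succ'] at h
      simp [h]
  have h : ∀ i j, ∃ t, z (a ^ i * b ^ j) = some t := fun i j => by
    induction i with
    | zero => simpa using Option.isSome_iff_exists.1 (hb j)
    | succ i ih =>
      obtain ⟨c, hc⟩ := ih
      obtain ⟨r, u, v, h, -⟩ := hz _ c hc
      exact ⟨r, by simpa only [pow_succ', mul_assoc] using h⟩
  choose y hy using h
  refine ⟨y, Option.some_injective _ (by rw [← hy, ← ht]; simp), fun i j => ?_, hy⟩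
  obtain ⟨r, u, v, hr, hu, hv, h⟩ := hz _ _ (hy i j)
  have hba : b * (a ^ i * b ^ j) = a ^ i * b ^ (j + 1) := by
    rw [← mul_assoc, ← ((Commute.pow_left hab i).eq : a ^ i * b = b * a ^ i), mul_assoc, pow_succ']
  simp only [mul_assoc, hba] at hr hu hv
  simp only [← mul_assoc, ← pow_succ', hy, Option.some_inj] at hr hu hv
  rwa [← hr, ← hu, ← hv] at h

theorem exists_action_partialRule {G : Type} [Group G] [Countable G] {a b : G} (hab : a * b = b * a)
    (hfree : ∀ i j : ℤ, a ^ i * b ^ j = 1 → i = 0 ∧ j = 0) {T : Type} [Finite T]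
    {rule : T → T → T → T → Prop} {x : ℕ → ℕ → T}
    (hx : ∀ i j, rule (x i j) (x (i + 1) j) (x i (j + 1)) (x (i + 1) (j + 1)))
    (hxs : ∀ t, ∃ i j, x i j = t) [TopologicalSpace (Option T)] [DiscreteTopology (Option T)]
    {P : Cantor → Option T} (hP : Continuous P) (hPs : Function.Surjective P) :
    ∃ β : ActSpace G, ∀ p,
      PartialRule rule (P p, P (β.1 a p), P (β.1 b p), P (β.1 (a * b) p)) := by
  classical
  have hinj : ∀ i j i' j' : ℕ, a ^ i * b ^ j = a ^ i' * b ^ j' → i = i' ∧ j = j' := by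
    intro i j i' j' h
    have hc : Commute a b := hab
    have := hfree (i - i') (j - j') (by
      rw [zpow_sub, zpow_sub, zpow_natCast, zpow_natCast, zpow_natCast, zpow_natCast, mul_assoc,
        ← mul_assoc (a ^ i')⁻¹, ((hc.pow_pow i' j).inv_left).eq, ← mul_assoc, ← mul_assoc, h,
        ← (hc.pow_pow i' j').eq.symm]
      simp [mul_assoc])
    omega
  let Z : Set (G → Option T) :=
    {z | ∀ h, PartialRule rule (z h, z (a * h), z (b * h), z (a * b * h))}
  have hZ : IsClosed Z := by
    have : Z = ⋂ h, (fun z : G → Option T => (z h, z (a * h), z (b * h), z (a * b * h))) ⁻¹'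
        {l | PartialRule rule l} := by
      ext z
      simp [Z]
    rw [this]
    exact isClosed_iInter fun h => (isClosed_discrete _).preimage (by fun_prop)
  have hinv : ∀ z ∈ Z, ∀ g, (fun h => z (h * g)) ∈ Z := fun z hz g h => by
    simpa only [mul_assoc] using hz (h * g)
  let z₀ : G → Option T := fun g =>
    if h : ∃ ij : ℕ × ℕ, a ^ ij.1 * b ^ ij.2 = g then some (x h.choose.1 h.choose.2) else none
  have hz₀ : ∀ i j, z₀ (a ^ i * b ^ j) = some (x i j) := fun i j => by
    have h : ∃ ij : ℕ × ℕ, a ^ ij.1 * b ^ ij.2 = a ^ i * b ^ j := ⟨(i, j), rfl⟩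
    obtain ⟨h1, h2⟩ := hinj _ _ _ _ h.choose_spec
    simp only [z₀, dif_pos h, h1, h2]
  have hz₀Z : z₀ ∈ Z := by
    intro g c hc
    change z₀ g = some c at hc
    by_cases h : ∃ ij : ℕ × ℕ, a ^ ij.1 * b ^ ij.2 = g
    · obtain ⟨⟨i, j⟩, rfl⟩ := h
      have hba : b * (a ^ i * b ^ j) = a ^ i * b ^ (j + 1) := by
        rw [← mul_assoc, ← ((Commute.pow_left hab i).eq : a ^ i * b = b * a ^ i), mul_assoc,
          pow_succ']
      rw [hz₀, Option.some_inj] at hc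
      refine ⟨_, _, _, ?_, ?_, ?_, hc ▸ hx i j⟩
      · change z₀ (a * (a ^ i * b ^ j)) = _
        rw [← mul_assoc, ← pow_succ', hz₀]
      · change z₀ (b * (a ^ i * b ^ j)) = _
        rw [hba, hz₀]
      · change z₀ (a * b * (a ^ i * b ^ j)) = _
        rw [mul_assoc, hba, ← mul_assoc, ← pow_succ', hz₀]
    · exact absurd ((dif_neg h).symm.trans hc) (by simp)
  obtain ⟨β, hβ⟩ := exists_action_of_configurations hP hPs hZ hinv fun l => by
    cases l with
    | none =>
      refine ⟨_, hinv z₀ hz₀Z a⁻¹, dif_neg ?_⟩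
      rintro ⟨⟨i, j⟩, h⟩
      have := hfree (i + 1) j (by
        rw [add_comm, zpow_one_add, zpow_natCast, zpow_natCast, mul_assoc, h]
        simp)
      omega
    | some t =>
      obtain ⟨i, j, rfl⟩ := hxs t
      exact ⟨_, hinv z₀ hz₀Z (a ^ i * b ^ j), by rw [one_mul, hz₀]⟩
  refine ⟨β, fun p => ?_⟩
  obtain ⟨z, hz, h⟩ := hβ p
  have := hz 1
  simp only [mul_one, ← h, β.2.1] at this
  exact this

/-- A finite set of tiles, all of which occur in a given seeded tiling of the quadrant, such that
no seeded tiling has a computable sequence of bits along its first row. -/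
theorem exists_noncomputable_tiles_surjective : ∃ (T : Type) (_ : Finite T) (seed : T)
    (bit : T → Bool) (rule : T → T → T → T → Prop),
    (∃ x : ℕ → ℕ → T,
      (∀ i j, rule (x i j) (x (i + 1) j) (x i (j + 1)) (x (i + 1) (j + 1))) ∧
      ∀ t, ∃ i j, x i j = t) ∧
    ∀ f : ℕ → Bool, Computable f → ∃ n, ∀ x : ℕ → ℕ → T, x 0 0 = seed →
      (∀ i j, rule (x i j) (x (i + 1) j) (x i (j + 1)) (x (i + 1) (j + 1))) →
        bit (x n 0) ≠ f n := by
  obtain ⟨T, hT, seed, bit, rule, ⟨x, hx0, hx⟩, hf⟩ := exists_noncomputable_tiles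
  refine ⟨{t // ∃ i j, x i j = t}, inferInstance, ⟨seed, 0, 0, hx0⟩, fun t => bit t,
    fun c r u v => rule c r u v, ⟨fun i j => ⟨x i j, i, j, rfl⟩, hx, fun ⟨t, i, j, h⟩ =>
      ⟨i, j, Subtype.ext h⟩⟩, fun f hfc => ?_⟩
  obtain ⟨n, hn⟩ := hf f hfc
  exact ⟨n, fun y hy0 hy => hn (fun i j => y i j) (congrArg Subtype.val hy0) hy⟩

/-- A finitely generated nilpotent group with no cyclic subgroup of
finite index does not have the strong topological Rokhlin property. -/
theorem no_strp_of_nilpotent_not_virtually_cyclic (G : Type) [Group G] [Countable G]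
    (hfg : Group.FG G) (hnil : Group.IsNilpotent G)
    (hnvc : ∀ H : Subgroup G, H.index ≠ 0 → ¬ IsCyclic H) :
    ¬ HasSTRP G := by
  rintro ⟨α, hC⟩
  obtain ⟨a, b, hab, hfree⟩ := Group.IsNilpotent.exists_free_abelian_pair G hnvc
  obtain ⟨T, hT, seed, bit, rule, ⟨x, hx, hxs⟩, hcomp⟩ := exists_noncomputable_tiles_surjective
  obtain ⟨m, π, hπ⟩ := exists_surjective_digits (Option T)
  let _ : TopologicalSpace (Option T) := ⊥
  have : DiscreteTopology (Option T) := ⟨rfl⟩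
  have := ActSpace.baireSpace G
  let P : Cantor → Option T := fun p => π (Cantor.truncate m p)
  have hP : Continuous P := continuous_of_discreteTopology.comp (Cantor.continuous_truncate m)
  have hPs : Function.Surjective P := hπ.comp (Cantor.surjective_truncate m)
  have hPe : ∀ g : G, Continuous fun q : ActSpace G × Cantor => P (q.1.1 g q.2) := fun g =>
    hP.comp (ActSpace.continuous_eval g)
  let S : Bool → Set (Option T × Option T) := fun c =>
    {l | l.1 = some seed ∧ ∃ t, l.2 = some t ∧ bit t = c}
  let D : ℕ × Bool → Set (ActSpace G) := fun k => {β | ∃ p, (P p, P (β.1 (a ^ k.1) p)) ∈ S k.2}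
  have hD : ∀ k, IsClopen (D k) := fun k =>
    isClopen_setOf_exists (f := fun q : ActSpace G × Cantor => (P q.2, P (q.1.1 (a ^ k.1) q.2)))
      ((hP.comp continuous_snd).prodMk (hPe _)) (S k.2)
  let U : Set (ActSpace G) := {β | ∀ p,
    PartialRule rule (P p, P (β.1 a p), P (β.1 b p), P (β.1 (a * b) p))}
  have hU : IsOpen U := by
    have := (isClopen_setOf_exists
      (f := fun q : ActSpace G × Cantor =>
        (P q.2, P (q.1.1 a q.2), P (q.1.1 b q.2), P (q.1.1 (a * b) q.2)))
      ((hP.comp continuous_snd).prodMk ((hPe _).prodMk ((hPe _).prodMk (hPe _))))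
      {l | ¬ PartialRule rule l}).compl.isOpen
    convert this
    ext β
    simp [U]
  have hI : Countable C(Cantor, Option T) := countable_continuousMap_cantor _
  obtain ⟨V, hVU, hV, ⟨α₀, hα₀⟩, hconst⟩ := exists_open_constant_events hC hU
    (exists_action_partialRule hab hfree hx hxs hP hPs) hD
    (t := fun (ψ : C(Cantor, Option T)) k => ∃ q, (ψ q, ψ (α.1 (a ^ k.1) q)) ∈ S k.2) (by
      rintro β ⟨φ, hφ⟩
      refine ⟨⟨P ∘ φ, hP.comp φ.continuous⟩, fun k => ?_⟩
      change (∃ p, (P p, P (β.1 (a ^ k.1) p)) ∈ S k.2) ↔ _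
      rw [hφ, φ.surjective.exists]
      simp)
  have htile : ∀ p, P p = some seed → ∃ y : ℕ → ℕ → T, y 0 0 = seed ∧
      (∀ i j, rule (y i j) (y (i + 1) j) (y i (j + 1)) (y (i + 1) (j + 1))) ∧
      ∀ i j, P (α₀.1 (a ^ i * b ^ j) p) = some (y i j) := fun p hp => by
    refine PartialRule.exists_tiling (z := fun g => P (α₀.1 g p)) hab (fun h => ?_) ?_
    · simp only [α₀.2.2 _ h]
      exact hVU hα₀ (α₀.1 h p)
    · simp only [α₀.2.1]
      exact hp
  obtain ⟨f, hf, hfS⟩ := exists_computable_of_constant_events hfg a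
    (fun c => {w | (π w.1, π w.2) ∈ S c}) hV hα₀
    (fun β hβ n c => (hconst α₀ hα₀ β hβ (n, c)).1) fun n => by
      obtain ⟨p, hp⟩ := hPs (some seed)
      obtain ⟨y, -, -, hy⟩ := htile p hp
      exact ⟨_, p, hp, _, by simpa using hy n 0, rfl⟩
  obtain ⟨n, hn⟩ := hcomp f hf
  obtain ⟨p, hp, t, ht, hbit⟩ := hfS n
  obtain ⟨y, hy0, hy, hyP⟩ := htile p hp
  refine hn y hy0 hy ?_
  have := hyP n 0
  rw [pow_zero, mul_one] at this
  rw [← hbit, Option.some_inj.1 (this.symm.trans ht)]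
end

section
/- Let G be a countable group such that for every finitely generated subgroup H ≤ G there exists g ∈ G \ H satisfying at least one of the following: (1) g centralizes H, i.e. g·h = h·g for all h ∈ H; (2) the subgroup generated by g and H is the free product of the cyclic subgroup ⟨g⟩ with H, i.e. the canonical homomorphism from the group coproduct ⟨g⟩ ∗ H to G induced by the inclusions of ⟨g⟩ and of H is injective. Then G does not have the strong topological Rokhlin property. -/
open Topology

/-- Two points of the Cantor space agree in their first `n` coordinates. -/
def AgreeTo (n : ℕ) (x y : Cantor) : Prop := ∀ i < n, x i = y i

namespace AgreeTo

theorem refl (n : ℕ) (x : Cantor) : AgreeTo n x x := fun _ _ => rfl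

theorem symm {n : ℕ} {x y : Cantor} (h : AgreeTo n x y) : AgreeTo n y x :=
  fun i hi => (h i hi).symm

theorem trans {n : ℕ} {x y z : Cantor} (h : AgreeTo n x y) (h' : AgreeTo n y z) :
    AgreeTo n x z :=
  fun i hi => (h i hi).trans (h' i hi)

theorem mono {m n : ℕ} (hmn : m ≤ n) {x y : Cantor} (h : AgreeTo n x y) : AgreeTo m x y :=
  fun i hi => h i (hi.trans_le hmn)

end AgreeTo

theorem exists_agreeTo_subset_of_mem_uniformity {V : Set (Cantor × Cantor)}
    (hV : V ∈ uniformity Cantor) : ∃ n, ∀ x y, AgreeTo n x y → (x, y) ∈ V := by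
  rw [Pi.uniformity, Filter.mem_iInf'] at hV
  obtain ⟨I, hI, W, hW, -, rfl, -⟩ := hV
  obtain ⟨n, hn⟩ := hI.bddAbove
  refine ⟨n + 1, fun x y hxy => Set.mem_iInter₂.2 fun i hi => ?_⟩
  obtain ⟨T, hT, hTW⟩ := Filter.mem_comap.1 (hW i)
  refine hTW ?_
  have : x i = y i := hxy i (Nat.lt_succ_of_le (hn hi))
  simpa [this] using mem_uniformity_of_eq hT rfl

theorem setOf_agreeTo_mem_uniformity (n : ℕ) :
    {p : Cantor × Cantor | AgreeTo n p.1 p.2} ∈ uniformity Cantor := by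
  have : {p : Cantor × Cantor | AgreeTo n p.1 p.2} =
      ⋂ i ∈ Finset.range n, {p : Cantor × Cantor | p.1 i = p.2 i} := by
    ext p
    simp [AgreeTo]
  rw [this, Filter.biInter_finset_mem]
  intro i _
  rw [Pi.uniformity]
  refine Filter.mem_iInf_of_mem i (Filter.mem_comap.2 ⟨{p | p.1 = p.2}, ?_, fun p hp => hp⟩)
  exact DiscreteUniformity.relId_mem_uniformity Bool

theorem exists_modulus {f : Cantor → Cantor} (hf : Continuous f) (n : ℕ) :
    ∃ m, ∀ x y, AgreeTo m x y → AgreeTo n (f x) (f y) :=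
  exists_agreeTo_subset_of_mem_uniformity
    (CompactSpace.uniformContinuous_of_continuous hf (setOf_agreeTo_mem_uniformity n))

theorem setOf_agreeTo_mem_nhds (n : ℕ) (u : C(Cantor, Cantor)) :
    {v : C(Cantor, Cantor) | ∀ z, AgreeTo n (u z) (v z)} ∈ 𝓝 u :=
  (nhds_basis_uniformity' (x := u)
    ContinuousMap.hasBasis_compactConvergenceUniformity_of_compact).mem_of_mem
    (setOf_agreeTo_mem_uniformity n)

theorem exists_agreeTo_subset_of_mem_nhds {u : C(Cantor, Cantor)} {N : Set C(Cantor, Cantor)}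
    (hN : N ∈ 𝓝 u) : ∃ n, ∀ v : C(Cantor, Cantor), (∀ z, AgreeTo n (u z) (v z)) → v ∈ N := by
  obtain ⟨V, hV, hVN⟩ := (nhds_basis_uniformity' (x := u)
    ContinuousMap.hasBasis_compactConvergenceUniformity_of_compact).mem_iff.1 hN
  obtain ⟨n, hn⟩ := exists_agreeTo_subset_of_mem_uniformity hV
  exact ⟨n, fun v hv => hVN fun z => hn _ _ (hv z)⟩

variable {G : Type} [Group G]

theorem ActSpace.setOf_agreeTo_mem_nhds (n : ℕ) (g : G) (β : ActSpace G) :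
    {β' : ActSpace G | ∀ z, AgreeTo n (β.1 g z) (β'.1 g z)} ∈ 𝓝 β :=
  ((continuous_apply g).comp continuous_subtype_val).continuousAt.preimage_mem_nhds
    (_root_.setOf_agreeTo_mem_nhds n (β.1 g))

theorem ActSpace.exists_agreeTo_subset_of_mem_nhds {β : ActSpace G} {N : Set (ActSpace G)}
    (hN : N ∈ 𝓝 β) : ∃ (F : Finset G) (n : ℕ), ∀ β' : ActSpace G,
      (∀ g ∈ F, ∀ z, AgreeTo n (β.1 g z) (β'.1 g z)) → β' ∈ N := by
  obtain ⟨U, hU, hUN⟩ := (mem_nhds_induced _ _ _).1 hN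
  rw [nhds_pi, Filter.mem_pi] at hU
  obtain ⟨I, hI, t, ht, htU⟩ := hU
  choose n hn using fun g => _root_.exists_agreeTo_subset_of_mem_nhds (ht g)
  refine ⟨hI.toFinset, hI.toFinset.sup n, fun β' h => hUN (htU fun g hg => hn g _ fun z => ?_)⟩
  have hg' : g ∈ hI.toFinset := hI.mem_toFinset.2 hg
  exact (h g hg' z).mono (Finset.le_sup hg')

theorem isClosed_setOf_isAction : IsClosed {α : G → C(Cantor, Cantor) | IsAction G α} := by
  refine IsClosed.inter (isClosed_eq (continuous_apply 1) continuous_const) ?_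
  change IsClosed {α : G → C(Cantor, Cantor) | ∀ g h, α (g * h) = (α g).comp (α h)}
  simp only [Set.ofPred_forall]
  refine isClosed_iInter fun g => isClosed_iInter fun h => ?_
  exact isClosed_eq (continuous_apply _) ((continuous_apply g).compCM (continuous_apply h))

instance [Countable G] : BaireSpace (ActSpace G) := by
  have : CompleteSpace (ActSpace G) :=
    (isClosed_setOf_isAction (G := G)).isComplete.completeSpace_coe
  have : Filter.IsCountablyGenerated (uniformity Bool) := by
    rw [DiscreteUniformity.eq_principal_setRelId]
    infer_instance
  have : Filter.IsCountablyGenerated (uniformity (ActSpace G)) := by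
    rw [uniformity_subtype]
    infer_instance
  infer_instance

instance : Countable C(Cantor, Bool) := by
  have : Countable (TopologicalSpace.Clopens Cantor) :=
    TopologicalSpace.Clopens.countable_iff_secondCountable.2 inferInstance
  refine Function.Injective.countable (β := TopologicalSpace.Clopens Cantor)
    (f := fun d => ⟨d ⁻¹' {true}, (isClopen_discrete _).preimage d.continuous⟩) fun d d' h => ?_
  ext z
  have : d z = true ↔ d' z = true := by
    simpa using congrArg (fun C : TopologicalSpace.Clopens Cantor => z ∈ (C : Set Cantor)) h
  exact Bool.eq_iff_iff.2 this

theorem exists_equiv_nat_extending {Q : Type} [Countable Q] (q : Q) (m : ℕ) :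
    ∃ e : ℕ × Q ≃ ℕ, ∀ i < m, e (i, q) = i := by
  have : Nonempty Q := ⟨q⟩
  obtain ⟨e₀⟩ := nonempty_equiv_of_countable (α := ℕ × Q) (β := ℕ)
  have := Equiv.Perm.isMultiplyPretransitive ℕ m
  obtain ⟨σ, hσ⟩ := MulAction.exists_smul_eq (Equiv.Perm ℕ)
    (⟨fun i : Fin m => e₀ (i, q), fun i j h => by simpa [Fin.ext_iff] using h⟩ : Fin m ↪ ℕ)
    ⟨fun i => i, Fin.val_injective⟩
  exact ⟨e₀.trans σ, fun i hi => DFunLike.congr_fun hσ ⟨i, hi⟩⟩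

/-- Coinduction of an action on the Cantor space from a subgroup `K`: the resulting action of `G`
has `γ` as a `K`-factor via a map `π` not altering the first `m` coordinates, and every
`K`-equivariant function on `G` is the `π`-itinerary of some point. -/
theorem exists_coinduced [Countable G] (K : Subgroup G) (γ : K →* (Cantor ≃ₜ Cantor)) (m : ℕ) :
    ∃ (β : ActSpace G) (π : Cantor → Cantor), (∀ z, AgreeTo m (π z) z) ∧
      (∀ (k : K) z, π (β.1 k z) = γ k (π z)) ∧
      ∀ x : G → Cantor, (∀ (k : K) s, x (k * s) = γ k (x s)) → ∃ z, ∀ s, π (β.1 s z) = x s := by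
  classical
  let Q := Quotient (QuotientGroup.rightRel K)
  let q : G → Q := fun s => Quotient.mk _ s
  have hq : ∀ s t, q s = q t ↔ t * s⁻¹ ∈ K := fun s t =>
    Quotient.eq.trans QuotientGroup.rightRel_apply
  have hQ : Countable Q := Quotient.countable
  obtain ⟨e, he⟩ := exists_equiv_nat_extending (q 1) m
  let rep : Q → G := fun c => if c = q 1 then 1 else c.out
  have hrep : ∀ c, q (rep c) = c := by
    intro c
    by_cases hc : c = q 1
    · simp [rep, hc]
    · simp only [rep, hc, if_false]
      exact Quotient.out_eq c
  have hrep1 : rep (q 1) = 1 := if_pos rfl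
  let δ : G → K := fun s => ⟨s * (rep (q s))⁻¹, (hq _ _).1 (hrep _)⟩
  have hqk : ∀ (k : K) s, q (k * s) = q s := fun k s => ((hq _ _).2 (by simp)).symm
  have hδ : ∀ (k : K) s, δ (k * s) = k * δ s := fun k s => by
    ext
    simp [δ, hqk, mul_assoc]
  have hδrep : ∀ c, δ (rep c) = 1 := fun c => by
    ext
    simp [δ, hrep]
  have hδs : ∀ s, (δ s : G) * rep (q s) = s := fun s => by simp [δ]
  let dec : Cantor → G → Cantor := fun z s => γ (δ s) (fun i => z (e (i, q s)))
  let enc : (G → Cantor) → Cantor := fun x j => x (rep (e.symm j).2) (e.symm j).1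
  have dec_equivariant : ∀ z (k : K) s, dec z (k * s) = γ k (dec z s) := fun z k s => by
    simp [dec, hδ, hqk]
  have enc_dec : ∀ z, enc (dec z) = z := fun z => by
    ext j
    simp [enc, dec, hδrep, hrep]
  have dec_enc : ∀ x : G → Cantor, (∀ (k : K) s, x (k * s) = γ k (x s)) → dec (enc x) = x := by
    intro x hx
    funext s
    simp only [dec, enc, Equiv.symm_apply_apply]
    rw [← hx, hδs]
  have dec_continuous : ∀ s, Continuous fun z => dec z s := fun s =>
    (γ (δ s)).continuous.comp (continuous_pi fun i => continuous_apply _)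
  let β : G → C(Cantor, Cantor) := fun t =>
    ⟨fun z => enc fun s => dec z (s * t), continuous_pi fun j =>
      (continuous_apply _).comp (dec_continuous _)⟩
  have dec_β : ∀ t z s, dec (β t z) s = dec z (s * t) := fun t z s =>
    congrFun (dec_enc (fun s => dec z (s * t)) fun k s => by
      rw [mul_assoc, dec_equivariant]) s
  have hβ : IsAction G β := by
    refine ⟨?_, fun g h => ?_⟩
    · ext1 z
      simpa [β] using enc_dec z
    · ext1 z
      have : β g (β h z) = enc fun s => dec z (s * g * h) :=
        congrArg enc (funext fun s => dec_β h z (s * g))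
      rw [ContinuousMap.comp_apply, this]
      simp only [mul_assoc]
      rfl
  refine ⟨⟨β, hβ⟩, fun z => dec z 1, fun z i hi => ?_, fun k z => ?_, fun x hx =>
    ⟨enc x, fun s => ?_⟩⟩
  · have h1 : δ 1 = 1 := by simpa [hrep1] using hδrep (q 1)
    simp [dec, h1, he i hi]
  · change dec (β k z) 1 = _
    rw [dec_β, ← dec_equivariant]
    simp
  · change dec (β s _) 1 = _
    rw [dec_β, dec_enc x hx, one_mul]

/-- Version of `exists_coinduced` in which finitely many elements of the subgroup act on the first
`n` coordinates as prescribed. -/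
theorem exists_coinduced_agreeTo [Countable G] (K : Subgroup G) (γ : K →* (Cantor ≃ₜ Cantor))
    (F : Finset K) (n : ℕ) :
    ∃ (β : ActSpace G) (π : Cantor → Cantor), (∀ z, AgreeTo n (π z) z) ∧
      (∀ (k : K) z, π (β.1 k z) = γ k (π z)) ∧
      (∀ x : G → Cantor, (∀ (k : K) s, x (k * s) = γ k (x s)) → ∃ z, ∀ s, π (β.1 s z) = x s) ∧
      ∀ k ∈ F, ∀ z, AgreeTo n (γ k z) (β.1 k z) := by
  choose m hm using fun k : K => exists_modulus (γ k).continuous n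
  obtain ⟨β, π, hπ, hβ, hx⟩ := exists_coinduced K γ (max n (F.sup m))
  have hπ' : ∀ z, AgreeTo n (π z) z := fun z => (hπ z).mono (le_max_left _ _)
  refine ⟨β, π, hπ', hβ, hx, fun k hk z => ?_⟩
  refine AgreeTo.trans ?_ (hπ' _)
  rw [hβ]
  exact hm k _ _ ((hπ z).mono ((Finset.le_sup hk).trans (le_max_right _ _))).symm

/-- Some point `z` is such that `g • z` lies in a different two-bit cylinder than both `z` and
`g ^ 2 • z`. -/
def Separates (g : G) (β : ActSpace G) : Prop :=
  ∃ z, ¬ AgreeTo 2 (β.1 g z) z ∧ ¬ AgreeTo 2 (β.1 g z) (β.1 (g * g) z)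

theorem eventually_separates_iff (g : G) (β : ActSpace G) :
    ∀ᶠ β' in 𝓝 β, (Separates g β' ↔ Separates g β) := by
  filter_upwards [ActSpace.setOf_agreeTo_mem_nhds 2 g β,
    ActSpace.setOf_agreeTo_mem_nhds 2 (g * g) β] with β' h₁ h₂
  have key : ∀ z, (AgreeTo 2 (β'.1 g z) z ↔ AgreeTo 2 (β.1 g z) z) ∧
      (AgreeTo 2 (β'.1 g z) (β'.1 (g * g) z) ↔ AgreeTo 2 (β.1 g z) (β.1 (g * g) z)) := fun z =>
    ⟨⟨(h₁ z).trans, (h₁ z).symm.trans⟩, fun h => ((h₁ z).trans h).trans (h₂ z).symm,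
      fun h => ((h₁ z).symm.trans h).trans (h₂ z)⟩
  simp only [Separates, key]

/-- The part of the conjugacy class of `α` consisting of its conjugates by those `φ` whose first
two coordinate functions are `d`. -/
def conjClassWith (α : ActSpace G) (d : C(Cantor, Bool) × C(Cantor, Bool)) : Set (ActSpace G) :=
  {β | ∃ φ : Cantor ≃ₜ Cantor, (∀ z, φ z 0 = d.1 z ∧ φ z 1 = d.2 z) ∧ ∀ g : G,
    (β.1 g : Cantor → Cantor) = φ ∘ (α.1 g : Cantor → Cantor) ∘ φ.symm}

theorem conjClass_eq_iUnion (α : ActSpace G) : conjClass α = ⋃ d, conjClassWith α d := by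
  ext β
  rw [Set.mem_iUnion]
  constructor
  · rintro ⟨φ, hφ⟩
    exact ⟨(⟨fun z => φ z 0, (continuous_apply 0).comp φ.continuous⟩,
      ⟨fun z => φ z 1, (continuous_apply 1).comp φ.continuous⟩), φ, fun _ => ⟨rfl, rfl⟩, hφ⟩
  · rintro ⟨d, φ, -, hφ⟩
    exact ⟨φ, hφ⟩

theorem agreeTo_two_iff {x y : Cantor} : AgreeTo 2 x y ↔ x 0 = y 0 ∧ x 1 = y 1 := by
  constructor
  · exact fun h => ⟨h 0 (by norm_num), h 1 (by norm_num)⟩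
  · rintro ⟨h₀, h₁⟩ i hi
    interval_cases i
    exacts [h₀, h₁]

theorem Separates.of_mem_conjClassWith {α β β' : ActSpace G}
    {d : C(Cantor, Bool) × C(Cantor, Bool)} (hβ : β ∈ conjClassWith α d)
    (hβ' : β' ∈ conjClassWith α d) {g : G} (h : Separates g β) : Separates g β' := by
  obtain ⟨φ, hd, hφ⟩ := hβ
  obtain ⟨φ', hd', hφ'⟩ := hβ'
  obtain ⟨z, hz⟩ := h
  obtain ⟨w, rfl⟩ := φ.surjective z
  refine ⟨φ' w, ?_⟩
  simpa [hφ, hφ', agreeTo_two_iff, hd, hd'] using hz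

theorem not_hasSTRP_of_separates [Countable G]
    (h : ∀ (β : ActSpace G), ∀ N ∈ 𝓝 β,
      ∃ g : G, (∃ β₁ ∈ N, Separates g β₁) ∧ ∃ β₂ ∈ N, ¬ Separates g β₂) :
    ¬ HasSTRP G := by
  rintro ⟨α, hα⟩
  have : Nonempty (ActSpace G) := ⟨α⟩
  have hmeagre := not_isMeagre_of_mem_residual hα
  rw [conjClass_eq_iUnion] at hmeagre
  obtain ⟨d, hd⟩ : ∃ d, ¬ IsMeagre (conjClassWith α d) := by
    by_contra! hd
    exact hmeagre (isMeagre_iUnion hd)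
  obtain ⟨β, hβ⟩ : (interior (closure (conjClassWith α d))).Nonempty := by
    rw [Set.nonempty_iff_ne_empty]
    exact fun he => hd (IsNowhereDense.isMeagre he)
  obtain ⟨g, ⟨β₁, hβ₁, h₁⟩, β₂, hβ₂, h₂⟩ := h β _ (isOpen_interior.mem_nhds hβ)
  obtain ⟨δ₁, hδ₁, hδ₁'⟩ := mem_closure_iff_nhds.1 (interior_subset hβ₁) _
    (eventually_separates_iff g β₁)
  obtain ⟨δ₂, hδ₂, hδ₂'⟩ := mem_closure_iff_nhds.1 (interior_subset hβ₂) _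
    (eventually_separates_iff g β₂)
  exact h₂ (hδ₂.1 ((hδ₁.2 h₁).of_mem_conjClassWith hδ₁' hδ₂'))

/-- Prepending a bit. -/
def consHomeomorph : Bool × Cantor ≃ₜ Cantor where
  toFun p := fun i => Nat.casesOn i p.1 p.2
  invFun x := (x 0, fun i => x (i + 1))
  left_inv _ := rfl
  right_inv x := by
    ext (_ | _) <;> rfl
  continuous_toFun := continuous_pi fun i => by
    cases i with
    | zero => exact continuous_fst
    | succ i => exact (continuous_apply i).comp continuous_snd
  continuous_invFun := (continuous_apply 0).prodMk (continuous_pi fun _ => continuous_apply _)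

theorem nonempty_homeomorph_prod_fin (k : ℕ) : Nonempty (Cantor × Fin (k + 1) ≃ₜ Cantor) := by
  induction k with
  | zero => exact ⟨Homeomorph.prodUnique Cantor (Fin 1)⟩
  | succ k ih =>
    obtain ⟨θ⟩ := ih
    have e : Fin (k + 1 + 1) ≃ₜ Fin (k + 1) ⊕ Unit :=
      (finSuccEquivLast.trans (Equiv.optionEquivSumPUnit _)).toHomeomorphOfDiscrete
    have b : Unit ⊕ Unit ≃ₜ Bool := Equiv.boolEquivPUnitSumPUnit.symm.toHomeomorphOfDiscrete
    exact ⟨((Homeomorph.refl Cantor).prodCongr e).trans <|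
      (Homeomorph.prodSumDistrib).trans <|
      ((θ.trans (Homeomorph.prodUnique Cantor Unit).symm).sumCongr (Homeomorph.refl _)).trans <|
      Homeomorph.prodSumDistrib.symm.trans <|
      ((Homeomorph.refl Cantor).prodCongr b).trans <|
      (Homeomorph.prodComm _ _).trans consHomeomorph⟩

theorem exists_homeomorph_prod_fin (k m : ℕ) :
    ∃ θ : Cantor × Fin (k + 1) ≃ₜ Cantor, ∀ y, AgreeTo m (θ y) y.1 := by
  induction m with
  | zero =>
    obtain ⟨θ⟩ := nonempty_homeomorph_prod_fin k
    exact ⟨θ, fun _ i hi => absurd hi (Nat.not_lt_zero i)⟩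
  | succ m ih =>
    obtain ⟨θ, hθ⟩ := ih
    refine ⟨(consHomeomorph.symm.prodCongr (Homeomorph.refl _)).trans <|
      (Homeomorph.prodAssoc _ _ _).trans <|
      ((Homeomorph.refl _).prodCongr θ).trans consHomeomorph, ?_⟩
    rintro ⟨x, j⟩ (_ | i) hi
    · rfl
    · exact hθ (fun i => x (i + 1), j) i (Nat.lt_of_succ_lt_succ hi)

/-- Conjugation by a homeomorphism. -/
def homeomorphConj {X Y : Type} [TopologicalSpace X] [TopologicalSpace Y] (θ : X ≃ₜ Y) :
    (X ≃ₜ X) →* (Y ≃ₜ Y) where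
  toFun f := (θ.symm.trans f).trans θ
  map_one' := by
    ext
    simp
  map_mul' f f' := by
    ext
    simp

theorem homeomorphConj_apply {X Y : Type} [TopologicalSpace X] [TopologicalSpace Y] (θ : X ≃ₜ Y)
    (f : X ≃ₜ X) (y : Y) : homeomorphConj θ f y = θ (f (θ.symm y)) := rfl

/-- The action on a product that is trivial on the second factor. -/
def homeomorphProdRefl (X Y : Type) [TopologicalSpace X] [TopologicalSpace Y] :
    (X ≃ₜ X) →* (X × Y ≃ₜ X × Y) where
  toFun f := f.prodCongr (Homeomorph.refl Y)
  map_one' := rfl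
  map_mul' _ _ := rfl

theorem homeomorphProdRefl_apply {X Y : Type} [TopologicalSpace X] [TopologicalSpace Y]
    (f : X ≃ₜ X) (y : X × Y) : homeomorphProdRefl X Y f y = (f y.1, y.2) := rfl

/-- The root of `a × id` on `X × Fin (k + 1)` that rotates the second factor and applies `a`
once in every full turn. -/
def cyclicRoot {X : Type} [TopologicalSpace X] (a : X ≃ₜ X) (k : ℕ) :
    X × Fin (k + 1) ≃ₜ X × Fin (k + 1) where
  toFun y := (if y.2 + 1 = 0 then a y.1 else y.1, y.2 + 1)
  invFun y := (if y.2 = 0 then a.symm y.1 else y.1, y.2 - 1)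
  left_inv := by
    rintro ⟨x, i⟩
    by_cases hi : i + 1 = 0
    · simp [eq_neg_of_add_eq_zero_left hi]
    · simp [hi]
  right_inv := by
    rintro ⟨x, i⟩
    by_cases hi : i = 0 <;> simp [hi]
  continuous_toFun := by
    refine continuous_prod_of_discrete_right.2 fun i => ?_
    by_cases hi : i + 1 = 0 <;> simp only [hi, if_true, if_false] <;> fun_prop
  continuous_invFun := by
    refine continuous_prod_of_discrete_right.2 fun i => ?_
    by_cases hi : i = 0 <;> simp only [hi, if_true, if_false] <;> fun_prop

theorem cyclicRoot_apply {X : Type} [TopologicalSpace X] (a : X ≃ₜ X) (k : ℕ)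
    (y : X × Fin (k + 1)) :
    cyclicRoot a k y = (if y.2 + 1 = 0 then a y.1 else y.1, y.2 + 1) := rfl

theorem commute_cyclicRoot {X : Type} [TopologicalSpace X] {a b : X ≃ₜ X}
    (h : Commute b a) (k : ℕ) :
    Commute (homeomorphProdRefl X (Fin (k + 1)) b) (cyclicRoot a k) := by
  have hab : ∀ x, b (a x) = a (b x) := fun x => DFunLike.congr_fun h.eq x
  refine Homeomorph.ext ?_
  rintro ⟨x, i⟩
  by_cases hi : i + 1 = 0 <;> simp [cyclicRoot_apply, homeomorphProdRefl_apply, hi, hab]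

theorem cyclicRoot_pow {X : Type} [TopologicalSpace X] (a : X ≃ₜ X) (k : ℕ) :
    cyclicRoot a k ^ (k + 1) = homeomorphProdRefl X (Fin (k + 1)) a := by
  have h₀ : ∀ (x : X) (i : ℕ) (j : Fin (k + 1)), (j : ℕ) = i →
      (cyclicRoot a k ^ i) (x, 0) = (x, j) := by
    intro x i
    induction i with
    | zero =>
      intro j hj
      simp [Fin.ext_iff, hj]
    | succ i ih =>
      intro j hj
      have hi : i < k := by lia
      have hij : (⟨i, by lia⟩ : Fin (k + 1)) + 1 = j :=
        Fin.ext (by rw [Fin.val_add_one_of_lt (Fin.lt_def.2 hi), hj])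
      have hj₀ : j ≠ 0 := by
        rintro rfl
        simp at hj
      rw [pow_succ', Homeomorph.mul_apply, ih ⟨i, by lia⟩ rfl, cyclicRoot_apply]
      simp [hij, hj₀]
  have h₁ : ∀ x : X, (cyclicRoot a k ^ (k + 1)) (x, 0) = (a x, 0) := by
    intro x
    rw [pow_succ', Homeomorph.mul_apply, h₀ x k (Fin.last k) rfl, cyclicRoot_apply]
    simp
  refine Homeomorph.ext ?_
  rintro ⟨x, i⟩
  have hc := ((commute_cyclicRoot (Commute.refl a) k).pow_right i).eq
  rw [← h₀ x i i rfl, ← Homeomorph.mul_apply, ← Homeomorph.mul_apply, hc,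
    ((Commute.refl (cyclicRoot a k)).pow_pow _ _).eq, Homeomorph.mul_apply,
    Homeomorph.mul_apply, h₁]
  rfl

/-- Up to an extension not altering the first `m` coordinates, a central element acting on the
Cantor space has a root `T` of any order `n ≠ 1` commuting with the action, whose orbits never
change their image in the factor twice in a row. -/
theorem exists_extension_root {H : Type} [Group H] (A : H →* (Cantor ≃ₜ Cantor)) (a : H)
    (ha : ∀ b, Commute b a) {n : ℕ} (hn : n ≠ 1) (ha₀ : n = 0 → a = 1) (m : ℕ) :
    ∃ (A' : H →* (Cantor ≃ₜ Cantor)) (T : Cantor ≃ₜ Cantor) (p : Cantor → Cantor),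
      (∀ z, AgreeTo m (p z) z) ∧ (∀ b z, p (A' b z) = A b (p z)) ∧ (∀ b, Commute (A' b) T) ∧
      T ^ n = A' a ∧ ∀ z, p (T z) = p z ∨ p (T z) = p (T (T z)) := by
  obtain rfl | ⟨k, rfl⟩ : n = 0 ∨ ∃ k, n = k + 2 := by
    rcases n with _ | _ | k
    exacts [.inl rfl, absurd rfl hn, .inr ⟨k, rfl⟩]
  · exact ⟨A, 1, id, fun z => .refl m z, fun _ _ => rfl, fun _ => Commute.one_right _,
      by simp [ha₀ rfl], fun _ => .inl rfl⟩
  obtain ⟨θ, hθ⟩ := exists_homeomorph_prod_fin (k + 1) m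
  refine ⟨((homeomorphConj θ).comp (homeomorphProdRefl _ _)).comp A,
    homeomorphConj θ (cyclicRoot (A a) (k + 1)), fun z => (θ.symm z).1, fun z => ?_, fun b z => ?_,
    fun b => ?_, ?_, fun z => ?_⟩
  · simpa using (hθ (θ.symm z)).symm
  · simp [homeomorphConj_apply, homeomorphProdRefl_apply]
  · exact (commute_cyclicRoot ((ha b).map A) _).map (homeomorphConj θ)
  · rw [← map_pow, cyclicRoot_pow]
    rfl
  · obtain ⟨⟨x, i⟩, rfl⟩ := θ.surjective z
    by_cases hi : i + 1 = 0 <;> simp [homeomorphConj_apply, cyclicRoot_apply, hi]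

/-- The homomorphism into the homeomorphism group given by an action. -/
def ActSpace.toHomeomorph (β : ActSpace G) : G →* (Cantor ≃ₜ Cantor) where
  toFun g :=
    { toFun := β.1 g
      invFun := β.1 g⁻¹
      left_inv := fun z => by
        rw [← ContinuousMap.comp_apply, ← β.2.2, inv_mul_cancel, β.2.1, ContinuousMap.id_apply]
      right_inv := fun z => by
        rw [← ContinuousMap.comp_apply, ← β.2.2, mul_inv_cancel, β.2.1, ContinuousMap.id_apply]
      continuous_toFun := (β.1 g).continuous
      continuous_invFun := (β.1 g⁻¹).continuous }
  map_one' := Homeomorph.ext fun z => DFunLike.congr_fun β.2.1 z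
  map_mul' g h := Homeomorph.ext fun z => DFunLike.congr_fun (β.2.2 g h) z

theorem exists_monoidHom_range {L M : Type} [Group L] [Group M] (f : L →* G) (A : L →* M)
    (h : f.ker ≤ A.ker) : ∃ γ : f.range →* M, ∀ l, γ ⟨f l, l, rfl⟩ = A l := by
  refine ⟨f.rangeRestrict.liftOfSurjective f.rangeRestrict_surjective ⟨A, by simpa using h⟩,
    fun l => ?_⟩
  exact f.rangeRestrict.liftOfRightInverse_comp_apply _ _ ⟨A, by simpa using h⟩ l

theorem exists_nat_zpow_mem_iff (H : Subgroup G) (g : G) :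
    ∃ n : ℕ, ∀ i : ℤ, g ^ i ∈ H ↔ (n : ℤ) ∣ i := by
  obtain ⟨a, ha⟩ := Int.subgroup_cyclic (Subgroup.toAddSubgroup (H.comap (zpowersHom G g)))
  refine ⟨a.natAbs, fun i => ?_⟩
  rw [Int.natAbs_dvd, ← Int.mem_zmultiples_iff, AddSubgroup.zmultiples_eq_closure, ← ha]
  rfl

/-- The data of an action of a subgroup containing `H` and `g` which extends an action of `H` up to
a factor map `p` not altering the first `m` coordinates, and in which applying `g` twice never
changes the image under `p` twice in a row. -/
def HasTameExtension (H : Subgroup G) (g : G) : Prop :=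
  ∀ (A : H →* (Cantor ≃ₜ Cantor)) (m : ℕ),
    ∃ (K : Subgroup G) (γ : K →* (Cantor ≃ₜ Cantor)) (p : Cantor → Cantor) (hg : g ∈ K)
      (hH : H ≤ K), (∀ z, AgreeTo m (p z) z) ∧
      (∀ (b : H) z, p (γ (Subgroup.inclusion hH b) z) = A b (p z)) ∧
      ∀ z, p (γ ⟨g, hg⟩ z) = p z ∨ p (γ ⟨g, hg⟩ z) = p (γ (⟨g, hg⟩ * ⟨g, hg⟩) z)

theorem hasTameExtension_of_coprod {H : Subgroup G} {g : G}
    (h : Function.Injective (Monoid.Coprod.lift (Subgroup.zpowers g).subtype H.subtype)) :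
    HasTameExtension H g := by
  intro A m
  obtain ⟨γ, hγ⟩ := exists_monoidHom_range
    (Monoid.Coprod.lift (Subgroup.zpowers g).subtype H.subtype)
    (Monoid.Coprod.lift (1 : Subgroup.zpowers g →* (Cantor ≃ₜ Cantor)) A)
    (by rw [(MonoidHom.ker_eq_bot_iff _).2 h]; exact bot_le)
  have hH : H ≤ (Monoid.Coprod.lift (Subgroup.zpowers g).subtype H.subtype).range := fun b hb =>
    ⟨Monoid.Coprod.inr ⟨b, hb⟩, by simp⟩
  have hg : g ∈ (Monoid.Coprod.lift (Subgroup.zpowers g).subtype H.subtype).range :=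
    ⟨Monoid.Coprod.inl ⟨g, Subgroup.mem_zpowers g⟩, by simp⟩
  refine ⟨_, γ, id, hg, hH, fun z => .refl m z, fun b z => ?_, fun z => .inl ?_⟩
  · have := hγ (Monoid.Coprod.inr b)
    simp only [Monoid.Coprod.lift_apply_inr] at this
    exact DFunLike.congr_fun this z
  · have := hγ (Monoid.Coprod.inl ⟨g, Subgroup.mem_zpowers g⟩)
    simp only [Monoid.Coprod.lift_apply_inl] at this
    exact DFunLike.congr_fun this z

theorem hasTameExtension_of_commute {H : Subgroup G} {g : G} (hgH : g ∉ H)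
    (h : ∀ x ∈ H, g * x = x * g) : HasTameExtension H g := by
  intro A m
  obtain ⟨n, hn⟩ := exists_nat_zpow_mem_iff H g
  have hn₁ : n ≠ 1 := by
    rintro rfl
    exact hgH (by simpa using hn 1)
  have hcomm : ∀ (b : H) (i : ℤ), Commute (b : G) (g ^ i) := fun b i =>
    Commute.zpow_right (show Commute (b : G) g from (h b b.2).symm) i
  let a : H := ⟨g ^ (n : ℤ), (hn n).2 dvd_rfl⟩
  obtain ⟨A', T, p, hp, hA', hT, hTn, hpT⟩ := exists_extension_root A a
    (fun b => Subtype.ext (hcomm b n).eq) hn₁ (by rintro rfl; simp [a]) m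
  have hc₁ : ∀ (b : H) (i : Multiplicative ℤ), Commute (H.subtype b) (zpowersHom G g i) :=
    fun b i => hcomm b i.toAdd
  have hc₂ : ∀ (b : H) (i : Multiplicative ℤ),
      Commute (A' b) (zpowersHom (Cantor ≃ₜ Cantor) T i) :=
    fun b i => (hT b).zpow_right i.toAdd
  obtain ⟨γ, hγ⟩ := exists_monoidHom_range
    (H.subtype.noncommCoprod (zpowersHom G g) hc₁)
    (A'.noncommCoprod (zpowersHom _ T) hc₂) (by
      rintro ⟨b, i⟩ hbi
      simp only [MonoidHom.mem_ker, MonoidHom.noncommCoprod_apply, Subgroup.subtype_apply,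
        zpowersHom_apply] at hbi ⊢
      have hi : g ^ i.toAdd ∈ H := by
        rw [eq_inv_of_mul_eq_one_right hbi]
        exact H.inv_mem b.2
      obtain ⟨q, hq⟩ := (hn _).1 hi
      have hb : b = (a ^ q)⁻¹ := by
        ext
        rw [eq_inv_of_mul_eq_one_left hbi, hq, zpow_mul]
        rfl
      rw [hb, hq, zpow_mul, zpow_natCast, hTn, map_inv, map_zpow, inv_mul_cancel])
  have hH : H ≤ (H.subtype.noncommCoprod (zpowersHom G g) hc₁).range :=
    fun b hb => ⟨(⟨b, hb⟩, 1), by simp⟩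
  have hg : g ∈ (H.subtype.noncommCoprod (zpowersHom G g) hc₁).range :=
    ⟨(1, Multiplicative.ofAdd 1), by simp⟩
  have hγg : γ ⟨g, hg⟩ = T := by
    have := hγ (1, Multiplicative.ofAdd 1)
    simpa using this
  have hγH : ∀ b, γ (Subgroup.inclusion hH b) = A' b := fun b => by
    have := hγ (b, 1)
    simp only [map_one, MonoidHom.noncommCoprod_apply, mul_one] at this
    exact this
  refine ⟨_, γ, p, hg, hH, hp, fun b z => ?_, fun z => ?_⟩
  · rw [hγH, hA']
  · rw [map_mul, hγg]
    exact hpT z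

theorem exists_not_agreeTo_two (x y : Cantor) : ∃ w, ¬ AgreeTo 2 w x ∧ ¬ AgreeTo 2 w y := by
  refine ⟨fun i => if i = 0 then !x 0 else !y 1, ?_, ?_⟩ <;> simp [agreeTo_two_iff]

theorem agreeTo_iff_of_agreeTo {n : ℕ} {x x' y y' : Cantor} (hx : AgreeTo n x x')
    (hy : AgreeTo n y y') : AgreeTo n x y ↔ AgreeTo n x' y' :=
  ⟨fun h => (hx.symm.trans h).trans hy, fun h => (hx.trans h).trans hy.symm⟩

theorem exists_separates [Countable G] (β : ActSpace G) (H : Subgroup G) {g : G} (hg : g ∉ H)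
    (F : Finset H) (n : ℕ) : ∃ β' : ActSpace G, Separates g β' ∧
      ∀ b ∈ F, ∀ z, AgreeTo n (β.1 b z) (β'.1 b z) := by
  classical
  obtain ⟨β', π, hπ, hK, hx, hF⟩ :=
    exists_coinduced_agreeTo H (β.toHomeomorph.comp H.subtype) F (max n 2)
  refine ⟨β', ?_, fun b hb z => (hF b hb z).mono (le_max_left _ _)⟩
  let x₀ : G → Cantor := fun s => π (β'.1 s default)
  have hx₀ : ∀ (k : H) s, x₀ (k * s) = β.toHomeomorph k (x₀ s) := fun k s => by
    simp only [x₀, β'.2.2, ContinuousMap.comp_apply, hK]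
    rfl
  obtain ⟨w, hw₁, hw₂⟩ := exists_not_agreeTo_two (x₀ 1) (x₀ (g * g))
  obtain ⟨z, hz⟩ := hx
    (fun s => if s * g⁻¹ ∈ H then β.toHomeomorph (s * g⁻¹) w else x₀ s) fun k s => by
      by_cases hs : s * g⁻¹ ∈ H
      · have hks : k * s * g⁻¹ ∈ H := by
          rw [mul_assoc]
          exact H.mul_mem k.2 hs
        simp only [hs, hks, if_true]
        rw [mul_assoc, map_mul]
        rfl
      · have hks : k * s * g⁻¹ ∉ H := by
          rwa [mul_assoc, H.mul_mem_cancel_left k.2]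
        simp only [hs, hks, if_false]
        exact hx₀ k s
  have hz₁ : π z = x₀ 1 := by
    have := hz 1
    simpa [β'.2.1, hg] using this
  have hzg : π (β'.1 g z) = w := by simpa using hz g
  have hzgg : π (β'.1 (g * g) z) = x₀ (g * g) := by simpa [hg] using hz (g * g)
  have hπ₂ : ∀ z, AgreeTo 2 (π z) z := fun z => (hπ z).mono (le_max_right _ _)
  refine ⟨z, ?_, ?_⟩
  · rwa [← agreeTo_iff_of_agreeTo (hπ₂ _) (hπ₂ _), hzg, hz₁]
  · rwa [← agreeTo_iff_of_agreeTo (hπ₂ _) (hπ₂ _), hzg, hzgg]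

theorem exists_not_separates [Countable G] (β : ActSpace G) {H : Subgroup G} {g : G}
    (h : HasTameExtension H g) (F : Finset H) (n : ℕ) : ∃ β' : ActSpace G, ¬ Separates g β' ∧
      ∀ b ∈ F, ∀ z, AgreeTo n (β.1 b z) (β'.1 b z) := by
  classical
  choose m hm using fun b : H => exists_modulus (β.1 b).continuous n
  obtain ⟨K, γ, p, hg, hH, hp, hpH, hpg⟩ :=
    h (β.toHomeomorph.comp H.subtype) (max (max n 2) (F.sup m))
  obtain ⟨β', -, -, -, -, hF⟩ := exists_coinduced_agreeTo K γ
    ({⟨g, hg⟩, ⟨g, hg⟩ * ⟨g, hg⟩} ∪ F.image (Subgroup.inclusion hH)) (max n 2)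
  have hp₂ : ∀ z, AgreeTo 2 (p z) z := fun z =>
    (hp z).mono ((le_max_right _ _).trans (le_max_left _ _))
  have hg₁ : ∀ z, AgreeTo 2 (p (γ ⟨g, hg⟩ z)) (β'.1 g z) := fun z =>
    (hp₂ _).trans ((hF ⟨g, hg⟩ (by simp) z).mono (le_max_right _ _))
  have hg₂ : ∀ z, AgreeTo 2 (p (γ (⟨g, hg⟩ * ⟨g, hg⟩) z)) (β'.1 (g * g) z) := fun z =>
    (hp₂ _).trans ((hF (⟨g, hg⟩ * ⟨g, hg⟩) (by simp) z).mono (le_max_right _ _))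
  refine ⟨β', ?_, fun b hb z => ?_⟩
  · rintro ⟨z, hz₁, hz₂⟩
    rcases hpg z with hz | hz
    · exact hz₁ ((agreeTo_iff_of_agreeTo (hg₁ z) (hp₂ z)).1 (hz ▸ .refl _ _))
    · exact hz₂ ((agreeTo_iff_of_agreeTo (hg₁ z) (hg₂ z)).1 (hz ▸ .refl _ _))
  · have h₁ : AgreeTo n (β.1 b z) (p (γ (Subgroup.inclusion hH b) z)) := by
      rw [hpH]
      exact hm b _ _ ((hp z).mono ((Finset.le_sup hb).trans (le_max_right _ _))).symm
    have h₂ := (hp (γ (Subgroup.inclusion hH b) z)).mono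
      ((le_max_left n 2).trans (le_max_left _ _))
    have h₃ := hF (Subgroup.inclusion hH b)
      (Finset.mem_union_right _ (Finset.mem_image_of_mem _ hb)) z
    exact (h₁.trans h₂).trans (h₃.mono (le_max_left _ _))

/-- If for every finitely generated subgroup `H ≤ G` there is
`g ∈ G \ H` which either centralizes `H` or generates together with `H` a free
product `⟨g⟩ ∗ H`, then `G` does not have the strong topological Rokhlin property. -/
theorem no_strp_of_escaping_elements (G : Type) [Group G] [Countable G]
    (h : ∀ H : Subgroup G, H.FG → ∃ g : G, g ∉ H ∧
      ((∀ x ∈ H, g * x = x * g) ∨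
        Function.Injective
          ⇑(Monoid.Coprod.lift (Subgroup.zpowers g).subtype H.subtype))) :
    ¬ HasSTRP G := by
  classical
  refine not_hasSTRP_of_separates fun β N hN => ?_
  obtain ⟨F, n, hF⟩ := ActSpace.exists_agreeTo_subset_of_mem_nhds hN
  obtain ⟨g, hg, hgH⟩ := h (Subgroup.closure F) ⟨F, rfl⟩
  let F' : Finset (Subgroup.closure (F : Set G)) :=
    F.attach.image fun f : {x // x ∈ F} => ⟨f.1, Subgroup.subset_closure f.2⟩
  have hF' : ∀ β' : ActSpace G, (∀ b ∈ F', ∀ z, AgreeTo n (β.1 b z) (β'.1 b z)) → β' ∈ N :=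
    fun β' hβ' => hF β' fun f hf => hβ' ⟨f, Subgroup.subset_closure hf⟩
      (Finset.mem_image.2 ⟨⟨f, hf⟩, Finset.mem_attach _ _, rfl⟩)
  have htame : HasTameExtension (Subgroup.closure (F : Set G)) g :=
    hgH.elim (hasTameExtension_of_commute hg) hasTameExtension_of_coprod
  obtain ⟨β₁, h₁, hβ₁⟩ := exists_separates β _ hg F' n
  obtain ⟨β₂, h₂, hβ₂⟩ := exists_not_separates β htame F' n
  exact ⟨g, ⟨β₁, hF' β₁ hβ₁, h₁⟩, β₂, hF' β₂ hβ₂, h₂⟩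
end
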